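/- arXiv:math/0602252 — 4 statements merged into one kernel-verified Lean document; each statement's English description precedes it below -/
import Mathlib

section
/- Let R be a commutative Noetherian ring, M ∈ D_qc(R), p a prime of R, and n ∈ ℤ such that the localization H_n(M)_p is nonzero and H_i(M)_p = 0 for all i < n. Then there exists a morphism φ : M → s^n(R/p) in D(R) such that the induced map H_n(φ) on n-th homology is nonzero. -/
open CategoryTheory CategoryTheory.Limits CategoryTheory.Pretriangulated

universe w

section Defs

variable (R : Type) [CommRing R] [HasDerivedCategory.{w} (ModuleCat R)]

/-- The `n`-th homology (homological indexing, so that `H_n (s M) = H_{n-1} M` where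
`s = ⟦1⟧`) of an object of the derived category `D(R)` of `R`-modules. -/
noncomputable def Hh (n : ℤ) (M : DerivedCategory (ModuleCat R)) : ModuleCat R :=
  (DerivedCategory.homologyFunctor (ModuleCat R) (-n)).obj M

/-- The object `s^n M` of `D(R)` given by a module `M` concentrated in homological
degree `n`. -/
noncomputable def sdeg (n : ℤ) (M : ModuleCat R) : DerivedCategory (ModuleCat R) :=
  (DerivedCategory.singleFunctor (ModuleCat R) (-n)).obj M

/-- Membership in `D_qc(R)`: all homology modules are finitely generated over `R`,
and all but finitely many of them vanish. -/
def memDqc (M : DerivedCategory (ModuleCat R)) : Prop :=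
  (∀ n : ℤ, Module.Finite R ↥(Hh R n M)) ∧
    {n : ℤ | ¬ IsZero (Hh R n M)}.Finite

/-- A cocomplete preaisle in `D(R)`: a class of objects closed under isomorphism,
suspension (`s = ⟦1⟧`), extensions, and arbitrary coproducts. -/
structure IsCocompletePreaisle (S : Set (DerivedCategory (ModuleCat R))) : Prop where
  mem_of_iso : ∀ ⦃X Y : DerivedCategory (ModuleCat R)⦄, (X ≅ Y) → X ∈ S → Y ∈ S
  shift_mem : ∀ ⦃X : DerivedCategory (ModuleCat R)⦄, X ∈ S → X⟦(1 : ℤ)⟧ ∈ S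
  ext_mem : ∀ ⦃X Y Z : DerivedCategory (ModuleCat R)⦄ (f : X ⟶ Y) (g : Y ⟶ Z)
    (h : Z ⟶ X⟦(1 : ℤ)⟧),
    (Triangle.mk f g h ∈ distTriang (DerivedCategory (ModuleCat R))) →
    X ∈ S → Z ∈ S → Y ∈ S
  coproduct_mem : ∀ ⦃ι : Type⦄ (X : ι → DerivedCategory (ModuleCat R)) (c : Cofan X),
    IsColimit c → (∀ i, X i ∈ S) → c.pt ∈ S

end Defs

open TensorProduct in
theorem aux_fun {R : Type} [CommRing R] [IsNoetherianRing R] (p : Ideal R) [hp : p.IsPrime]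
    (N : Type) [AddCommGroup N] [Module R N] [Module.Finite R N]
    (h : Nontrivial (LocalizedModule p.primeCompl N)) : ∃ α : N →ₗ[R] (R ⧸ p), α ≠ 0 := by
  have h1 : (⟨p, hp⟩ : PrimeSpectrum R) ∈ Module.support R N := h
  rw [Module.mem_support_iff_nontrivial_residueField_tensorProduct] at h1
  obtain ⟨v, hv⟩ := exists_ne (0 : p.ResidueField ⊗[R] N)
  have : ∃ β : Module.Dual p.ResidueField (p.ResidueField ⊗[R] N), β v ≠ 0 := by
    by_contra! hc
    exact hv ((Module.forall_dual_apply_eq_zero_iff p.ResidueField v).1 hc)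
  obtain ⟨β, hβ⟩ := this
  let g : N →ₗ[R] p.ResidueField := (β.restrictScalars R) ∘ₗ (TensorProduct.mk R p.ResidueField N 1)
  have hg : g ≠ 0 := by
    intro hg
    apply hβ
    induction v using TensorProduct.induction_on with
    | zero => simp
    | tmul x y =>
      have h2 : β (1 ⊗ₜ y) = 0 := LinearMap.congr_fun hg y
      have h3 : x ⊗ₜ[R] y = x • ((1 : p.ResidueField) ⊗ₜ[R] y) := by
        simp [TensorProduct.smul_tmul']
      rw [h3, map_smul, h2, smul_zero]
    | add x y hx hy =>
      have hz : ∀ z, β z = 0 := by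
        intro z
        induction z using TensorProduct.induction_on with
        | zero => simp
        | tmul x y =>
          have h2 : β (1 ⊗ₜ y) = 0 := LinearMap.congr_fun hg y
          have h3 : x ⊗ₜ[R] y = x • ((1 : p.ResidueField) ⊗ₜ[R] y) := by
            simp [TensorProduct.smul_tmul']
          rw [h3, map_smul, h2, smul_zero]
        | add x y hx hy => rw [map_add, hx, hy, add_zero]
      exact hz _
  have hS : Algebra.algebraMapSubmonoid (R ⧸ p) p.primeCompl = nonZeroDivisors (R ⧸ p) := by
    ext x
    obtain ⟨x, rfl⟩ := Ideal.Quotient.mk_surjective x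
    rw [mem_nonZeroDivisors_iff_ne_zero, ne_eq, Ideal.Quotient.eq_zero_iff_mem]
    constructor
    · rintro ⟨y, hy, hxy⟩ hx
      apply hy
      change y ∈ p
      rw [← Ideal.Quotient.eq_zero_iff_mem] at hx ⊢
      rw [← hx]; exact hxy
    · intro hx
      exact ⟨x, hx, rfl⟩
  have : IsLocalization (Algebra.algebraMapSubmonoid (R ⧸ p) p.primeCompl) p.ResidueField := by
    rw [hS]
    exact inferInstanceAs (IsFractionRing (R ⧸ p) p.ResidueField)
  have := (isLocalizedModule_iff_isLocalization (S := p.primeCompl) (A := R ⧸ p)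
    (Aₛ := p.ResidueField)).2 this
  have := Module.finitePresentation_of_finite R N
  obtain ⟨α, s, hα⟩ := Module.FinitePresentation.exists_lift_of_isLocalizedModule p.primeCompl
    (IsScalarTower.toAlgHom R (R ⧸ p) p.ResidueField).toLinearMap g
  refine ⟨α, ?_⟩
  rintro rfl
  apply hg
  rw [LinearMap.comp_zero] at hα
  ext x
  have h5 := LinearMap.congr_fun hα x
  have h6 : (s : R) • g x = 0 := h5.symm
  rw [Algebra.smul_def, mul_eq_zero] at h6
  rcases h6 with h6 | h6
  · exact absurd ((Ideal.algebraMap_residueField_eq_zero).1 h6) s.2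
  · exact h6

theorem aux_kill {R : Type} [CommRing R] (p : Ideal R) [hp : p.IsPrime]
    (N : Type) [AddCommGroup N] [Module R N] [Module.Finite R N]
    (h : Subsingleton (LocalizedModule p.primeCompl N)) : ∃ s : R, s ∉ p ∧ ∀ x : N, s • x = 0 := by
  have h1 : (⟨p, hp⟩ : PrimeSpectrum R) ∉ Module.support R N := Module.notMem_support_iff.2 h
  rw [Module.mem_support_iff_of_finite, SetLike.not_le_iff_exists] at h1
  obtain ⟨s, hs, hs'⟩ := h1
  exact ⟨s, hs', fun x => Module.mem_annihilator.1 hs x⟩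

set_option linter.unusedSectionVars false

section
variable (R : Type) [CommRing R] [HasDerivedCategory.{w} (ModuleCat R)]


theorem tri_left (T : Triangle (DerivedCategory (ModuleCat R))) (hT : T ∈ distTriang _)
    (a : ℤ) (h3 : T.obj₃.IsGE (a + 1)) : IsIso ((DerivedCategory.homologyFunctor (ModuleCat R) a).map T.mor₁) := by
  have : Epi ((DerivedCategory.homologyFunctor (ModuleCat R) a).map T.mor₁) := by
    rw [DerivedCategory.HomologySequence.epi_homologyMap_mor₁_iff T hT]
    exact (T.obj₃.isZero_of_isGE (a+1) a (by lia)).eq_of_tgt _ _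
  have : Mono ((DerivedCategory.homologyFunctor (ModuleCat R) a).map T.mor₁) := by
    rw [DerivedCategory.HomologySequence.mono_homologyMap_mor₁_iff T hT (a - 1) a]
    exact (T.obj₃.isZero_of_isGE (a+1) (a-1) (by lia)).eq_of_src _ _
  exact isIso_of_mono_of_epi _

theorem tri_right (T : Triangle (DerivedCategory (ModuleCat R))) (hT : T ∈ distTriang _)
    (a i : ℤ) (hi : a < i) (h3 : T.obj₁.IsLE a) : IsIso ((DerivedCategory.homologyFunctor (ModuleCat R) i).map T.mor₂) := by
  have : Epi ((DerivedCategory.homologyFunctor (ModuleCat R) i).map T.mor₂) := by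
    rw [DerivedCategory.HomologySequence.epi_homologyMap_mor₂_iff T hT i (i + 1)]
    exact (T.obj₁.isZero_of_isLE a (i + 1) (by lia)).eq_of_tgt _ _
  have : Mono ((DerivedCategory.homologyFunctor (ModuleCat R) i).map T.mor₂) := by
    rw [DerivedCategory.HomologySequence.mono_homologyMap_mor₂_iff T hT]
    exact (T.obj₁.isZero_of_isLE a i (by lia)).eq_of_src _ _
  exact isIso_of_mono_of_epi _

theorem ext_kill (T : Triangle (DerivedCategory (ModuleCat R))) (hT : T ∈ distTriang _)
    (a b : R) (ha : a • 𝟙 T.obj₁ = 0) (hb : b • 𝟙 T.obj₃ = 0) : (a * b) • 𝟙 T.obj₂ = 0 := by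
  obtain ⟨u, hu⟩ := Triangle.coyoneda_exact₂ T hT (b • 𝟙 T.obj₂) (by
    rw [Linear.smul_comp, Category.id_comp, ← Category.comp_id T.mor₂, ← Linear.comp_smul, hb,
      comp_zero])
  rw [mul_smul, hu, ← Linear.smul_comp, ← Category.comp_id u, ← Linear.comp_smul, ha, comp_zero,
    zero_comp]

theorem smul_obj_zero {X Y : ModuleCat R} (e : X ≅ Y) (s : R) (hs : ∀ x : X, s • x = 0) :
    ∀ y : Y, s • y = 0 := by
  intro y
  have h1 := congrArg e.hom.hom (hs (e.inv.hom y))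
  rw [map_smul, map_zero] at h1
  have h2 : e.hom.hom (e.inv.hom y) = y := congrArg (fun k => k.hom y) e.inv_hom_id
  rwa [h2] at h1

theorem smul_hom_zero {X Y : DerivedCategory (ModuleCat R)} (s : R) (hs : s • 𝟙 X = 0)
    (f : X ⟶ Y) : s • f = 0 := by
  rw [← Category.id_comp f, ← Linear.smul_comp, hs, zero_comp]

theorem extend {A M B W : DerivedCategory (ModuleCat R)} (f : A ⟶ M) (g : M ⟶ B)
    (d : B ⟶ A⟦(1 : ℤ)⟧) (hT : Triangle.mk f g d ∈ distTriang _) (s : R) (hs : s • 𝟙 B = 0)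
    (θ : A ⟶ W) : ∃ φ : M ⟶ W, s • θ = f ≫ φ := by
  have hk : s • 𝟙 (B⟦(-1 : ℤ)⟧) = 0 := by
    rw [← CategoryTheory.Functor.map_id, ← Functor.map_smul, hs, Functor.map_zero]
  have key : ∀ u : B⟦(-1 : ℤ)⟧ ⟶ A, u ≫ (s • θ) = 0 := fun u => by
    rw [Linear.comp_smul]
    exact smul_hom_zero R s hk _
  exact Triangle.yoneda_exact₂ _ (inv_rot_of_distTriang _ hT) (s • θ) (key _)

theorem smul_ne {X N : ModuleCat R} (p : Ideal R) (hp : p.IsPrime) (E : X ≅ N)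
    (α : X →ₗ[R] (R ⧸ p)) (hα : α ≠ 0) (s : R) (hs : s ∉ p) :
    s • (E.inv ≫ ModuleCat.ofHom α : N ⟶ ModuleCat.of R (R ⧸ p)) ≠ 0 := by
  intro h0
  apply hα
  have h3 : s • ModuleCat.ofHom α = 0 := by
    have : E.hom ≫ (s • (E.inv ≫ ModuleCat.ofHom α : N ⟶ ModuleCat.of R (R ⧸ p))) = 0 := by
      rw [h0, comp_zero]
    rwa [Linear.comp_smul, E.hom_inv_id_assoc] at this
  ext x
  have h4 : s • α x = 0 := congrArg (fun k => k.hom x) h3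
  rw [Algebra.smul_def, mul_eq_zero] at h4
  rcases h4 with h4 | h4
  · exact absurd (Ideal.Quotient.eq_zero_iff_mem.1 h4) hs
  · exact h4

theorem kill (p : Ideal R) (hp : p.IsPrime) (k : ℕ) :
    ∀ (a : ℤ) (Y : DerivedCategory (ModuleCat R)), Y.IsGE a → Y.IsLE (a + k - 1) →
    (∀ i, a ≤ i → ∃ s : R, s ∉ p ∧ ∀ x : (DerivedCategory.homologyFunctor (ModuleCat R) i).obj Y, s • x = 0) → ∃ s : R, s ∉ p ∧ s • 𝟙 Y = 0 := by
  induction k with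
  | zero =>
    intro a Y h1 h2 h3
    refine ⟨1, fun h => hp.ne_top ((Ideal.eq_top_iff_one p).2 h), ?_⟩
    have := DerivedCategory.TStructure.t.isZero Y (a + (0:ℕ) - 1) a (by simp)
    exact this.eq_of_src _ _
  | succ k ih =>
    intro a Y h1 h2 h3
    obtain ⟨A, B, hA, hB, f, g, d, hT⟩ :=
      DerivedCategory.TStructure.t.exists_triangle Y a (a + 1) rfl
    replace hA : A.IsLE a := ⟨hA⟩
    replace hB : B.IsGE (a + 1) := ⟨hB⟩
    have hr : ∀ i, a < i → IsIso ((DerivedCategory.homologyFunctor (ModuleCat R) i).map g) := fun i hi => tri_right R _ hT a i hi hA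
    have hf : IsIso ((DerivedCategory.homologyFunctor (ModuleCat R) a).map f) := tri_left R _ hT a hB
    have hBLE : B.IsLE (a + 1 + k - 1) := by
      rw [DerivedCategory.isLE_iff]
      intro i hi
      have := hr i (by lia)
      exact (Y.isZero_of_isLE (a + (k + 1 : ℕ) - 1) i (by push_cast; lia)).of_iso (asIso ((DerivedCategory.homologyFunctor (ModuleCat R) i).map g)).symm
    obtain ⟨b, hb, hb'⟩ := ih (a + 1) B hB hBLE (by
      intro i hi
      obtain ⟨s, hs, hs'⟩ := h3 i (by lia)
      have := hr i (by lia)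
      exact ⟨s, hs, smul_obj_zero R (asIso ((DerivedCategory.homologyFunctor (ModuleCat R) i).map g)) s hs'⟩)
    have hAGE : A.IsGE a := by
      rw [DerivedCategory.isGE_iff]
      intro i hi
      have : IsIso ((DerivedCategory.homologyFunctor (ModuleCat R) i).map f) :=
        tri_left R _ hT i (DerivedCategory.TStructure.t.isGE_of_ge B (i + 1) (a + 1))
      exact (Y.isZero_of_isGE a i hi).of_iso (asIso ((DerivedCategory.homologyFunctor (ModuleCat R) i).map f))
    obtain ⟨N, ⟨e⟩⟩ := DerivedCategory.exists_iso_singleFunctor_obj_of_isGE_of_isLE A a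
    obtain ⟨s, hs, hs'⟩ := h3 a le_rfl
    have hN := smul_obj_zero R ((asIso ((DerivedCategory.homologyFunctor (ModuleCat R) a).map f)).symm ≪≫ (DerivedCategory.homologyFunctor (ModuleCat R) a).mapIso e ≪≫
      (DerivedCategory.singleFunctorCompHomologyFunctorIso (ModuleCat R) a).app N) s hs'
    have hN' : s • 𝟙 N = 0 := by
      ext x
      exact hN x
    have hsA : s • 𝟙 A = 0 := by
      have : s • 𝟙 ((DerivedCategory.singleFunctor (ModuleCat R) a).obj N) = 0 := by
        rw [← CategoryTheory.Functor.map_id, ← Functor.map_smul, hN', Functor.map_zero]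
      rw [← e.hom_inv_id, ← Category.id_comp e.inv, ← Linear.comp_smul, ← Linear.smul_comp, this,
        zero_comp, comp_zero]
    exact ⟨s * b, fun h => (hp.mem_or_mem h).elim hs hb, ext_kill R _ hT s b hsA hb'⟩

end

theorem stmt3 (R : Type) [CommRing R] [IsNoetherianRing R]
    [HasDerivedCategory.{w} (ModuleCat R)]
    (M : DerivedCategory (ModuleCat R)) (hM : memDqc R M)
    (p : Ideal R) (hp : p.IsPrime) (n : ℤ)
    (h1 : Nontrivial (LocalizedModule p.primeCompl ↥(Hh R n M)))
    (h2 : ∀ i : ℤ, i < n → Subsingleton (LocalizedModule p.primeCompl ↥(Hh R i M))) :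
    ∃ φ : M ⟶ sdeg R n (ModuleCat.of R (R ⧸ p)),
      (DerivedCategory.homologyFunctor (ModuleCat R) (-n)).map φ ≠ 0 := by
  obtain ⟨hfin, hbd⟩ := hM
  obtain ⟨A, B, hA, hB, f, g, d, hT⟩ :=
    DerivedCategory.TStructure.t.exists_triangle M (-n) (-n + 1) rfl
  replace hA : A.IsLE (-n) := ⟨hA⟩
  replace hB : B.IsGE (-n + 1) := ⟨hB⟩
  have hf : IsIso ((DerivedCategory.homologyFunctor (ModuleCat R) (-n)).map f) :=
    tri_left R _ hT (-n) hB
  have hr : ∀ i, -n < i → IsIso ((DerivedCategory.homologyFunctor (ModuleCat R) i).map g) :=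
    fun i hi => tri_right R _ hT (-n) i hi hA
  -- kill B
  obtain ⟨s, hs, hsB⟩ : ∃ s : R, s ∉ p ∧ s • 𝟙 B = 0 := by
    obtain ⟨c, hc⟩ := hbd.bddBelow
    refine kill R p hp (n - c).toNat (-n + 1) B hB ?_ ?_
    · rw [DerivedCategory.isLE_iff]
      intro i hi
      have hi1 : -n < i := by lia
      have := hr i hi1
      refine IsZero.of_iso ?_ (asIso ((DerivedCategory.homologyFunctor (ModuleCat R) i).map g)).symm
      by_contra hcon
      have : c ≤ -i := hc (by
        change ¬ IsZero ((DerivedCategory.homologyFunctor (ModuleCat R) (- -i)).obj M)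
        rwa [neg_neg])
      lia
    · intro i hi
      have := hr i (by lia)
      have := hfin (-i)
      obtain ⟨s, hs, hs'⟩ := aux_kill p (Hh R (-i) M) (h2 (-i) (by lia))
      refine ⟨s, hs, smul_obj_zero R
        (asIso ((DerivedCategory.homologyFunctor (ModuleCat R) i).map g)) s ?_⟩
      unfold Hh at hs'
      rwa [neg_neg] at hs'
  -- A to single
  obtain ⟨A', Z, hA', hZ, f', q, d', hT'⟩ :=
    DerivedCategory.TStructure.t.exists_triangle A (-n - 1) (-n) (by lia)
  replace hA' : A'.IsLE (-n - 1) := ⟨hA'⟩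
  replace hZ : Z.IsGE (-n) := ⟨hZ⟩
  have hq : ∀ i, -n - 1 < i → IsIso ((DerivedCategory.homologyFunctor (ModuleCat R) i).map q) :=
    fun i hi => tri_right R _ hT' (-n - 1) i hi hA'
  have hZ' : Z.IsLE (-n) := by
    rw [DerivedCategory.isLE_iff]
    intro i hi
    have := hq i (by lia)
    exact (A.isZero_of_isLE _ i hi).of_iso
      (asIso ((DerivedCategory.homologyFunctor (ModuleCat R) i).map q)).symm
  obtain ⟨N, ⟨e⟩⟩ := DerivedCategory.exists_iso_singleFunctor_obj_of_isGE_of_isLE Z (-n)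
  have hqn := hq (-n) (by lia)
  let E : Hh R n M ≅ N :=
    (asIso ((DerivedCategory.homologyFunctor (ModuleCat R) (-n)).map f)).symm ≪≫
    asIso ((DerivedCategory.homologyFunctor (ModuleCat R) (-n)).map q) ≪≫
    (DerivedCategory.homologyFunctor (ModuleCat R) (-n)).mapIso e ≪≫
    (DerivedCategory.singleFunctorCompHomologyFunctorIso (ModuleCat R) (-n)).app N
  have := hfin n
  obtain ⟨α, hα⟩ := aux_fun p (Hh R n M) h1
  let α' : N ⟶ ModuleCat.of R (R ⧸ p) := E.inv ≫ ModuleCat.ofHom α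
  have hα' : s • α' ≠ 0 := smul_ne R p hp E α hα s hs
  let F := DerivedCategory.singleFunctor (ModuleCat R) (-n)
  let ψ : A ⟶ F.obj (ModuleCat.of R (R ⧸ p)) := q ≫ e.hom ≫ F.map (s • α')
  have h5 : s • (q ≫ e.hom ≫ F.map α') = ψ := by
    simp only [ψ, Functor.map_smul, Linear.comp_smul]
  obtain ⟨φ, hφ⟩ := extend R f g d hT s hsB (q ≫ e.hom ≫ F.map α')
  rw [h5] at hφ
  refine ⟨φ, fun h0 => hα' ?_⟩
  have h6 : (DerivedCategory.homologyFunctor (ModuleCat R) (-n)).map ψ = 0 := by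
    rw [hφ]
    refine (Functor.map_comp _ _ _).trans ?_
    exact (congrArg (fun k => _ ≫ k) h0).trans comp_zero
  simp only [ψ, Functor.map_comp] at h6
  have h7 : (DerivedCategory.homologyFunctor (ModuleCat R) (-n)).map (F.map (s • α')) = 0 := by
    have hE : IsIso ((DerivedCategory.homologyFunctor (ModuleCat R) (-n)).map e.hom) := inferInstance
    rw [← cancel_epi ((DerivedCategory.homologyFunctor (ModuleCat R) (-n)).map e.hom),
      ← cancel_epi ((DerivedCategory.homologyFunctor (ModuleCat R) (-n)).map q), h6]
    simp
  have h8 := NatIso.naturality_1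
    (DerivedCategory.singleFunctorCompHomologyFunctorIso (ModuleCat R) (-n)) (s • α')
  dsimp at h8
  rw [← h8]
  erw [h7]
  simp
end

section
/- Let R be a commutative Noetherian ring and let S be a class of objects of D(R) closed under isomorphism, under suspension (X ∈ S ⇒ sX ∈ S), under extensions (for every distinguished triangle X → Y → Z → sX with X, Z ∈ S, also Y ∈ S), and under countable coproducts. If X ∈ S and X ≅ A ⊕ B in D(R), then A ∈ S; that is, S is closed under direct summands (retracts). -/
open CategoryTheory CategoryTheory.Limits CategoryTheory.Pretriangulated

universe w

namespace Stmt5Aux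

noncomputable section

set_option linter.unusedSectionVars false

variable {C : Type*} [Category C] [Abelian C]
  [HasColimitsOfShape (Discrete ℕ) C] [HasExactColimitsOfShape (Discrete ℕ) C]

instance colimPZ : (colim : (Discrete ℕ ⥤ C) ⥤ C).PreservesZeroMorphisms where
  map_zero X Y := by
    apply colimit.hom_ext
    intro j
    simp


/-- family of complexes as a complex of families -/
def tot (K : ℕ → CochainComplex C ℤ) : CochainComplex (Discrete ℕ ⥤ C) ℤ where
  X n := Discrete.functor (fun i => (K i).X n)
  d m n := Discrete.natTrans (fun i => (K i.as).d m n)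
  shape m n h := by
    ext i
    exact (K i.as).shape m n h
  d_comp_d' a b c _ _ := by
    ext i
    exact (K i.as).d_comp_d a b c

def totMap {K L : ℕ → CochainComplex C ℤ} (t : ∀ i, K i ⟶ L i) : tot K ⟶ tot L where
  f n := Discrete.natTrans (fun i => (t i.as).f n)
  comm' m n _ := by
    ext i
    exact (t i.as).comm m n

lemma quasiIso_totMap {K L : ℕ → CochainComplex C ℤ} (t : ∀ i, K i ⟶ L i)
    (ht : ∀ i, QuasiIso (t i)) : QuasiIso (totMap t) := by
  rw [quasiIso_iff]
  intro n
  rw [quasiIsoAt_iff, ShortComplex.quasiIso_iff]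
  rw [NatTrans.isIso_iff_isIso_app]
  rintro ⟨i⟩
  have h1 : QuasiIsoAt (t i) n := (ht i).quasiIsoAt n
  rw [quasiIsoAt_iff, ShortComplex.quasiIso_iff] at h1
  have := ShortComplex.mapHomologyIso_hom_naturality
    ((HomologicalComplex.shortComplexFunctor _ _ n).map (totMap t))
    ((evaluation (Discrete ℕ) C).obj ⟨i⟩)
  have h2 : IsIso (ShortComplex.homologyMap (((evaluation (Discrete ℕ) C).obj ⟨i⟩).mapShortComplex.map
    ((HomologicalComplex.shortComplexFunctor _ _ n).map (totMap t)))) := h1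
  change IsIso (((evaluation (Discrete ℕ) C).obj ⟨i⟩).map (ShortComplex.homologyMap
    ((HomologicalComplex.shortComplexFunctor _ _ n).map (totMap t))))
  rw [← Iso.inv_comp_eq] at this
  rw [← this]
  exact IsIso.comp_isIso' inferInstance (IsIso.comp_isIso' h2 inferInstance)

/-- coproduct complex -/
def cop (K : ℕ → CochainComplex C ℤ) : CochainComplex C ℤ :=
  ((colim : (Discrete ℕ ⥤ C) ⥤ C).mapHomologicalComplex _).obj (tot K)

def copMap {K L : ℕ → CochainComplex C ℤ} (t : ∀ i, K i ⟶ L i) : cop K ⟶ cop L :=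
  ((colim : (Discrete ℕ ⥤ C) ⥤ C).mapHomologicalComplex _).map (totMap t)

lemma quasiIso_copMap {K L : ℕ → CochainComplex C ℤ} (t : ∀ i, K i ⟶ L i)
    (ht : ∀ i, QuasiIso (t i)) : QuasiIso (copMap t) := by
  have := quasiIso_totMap t ht
  have : (colim : (Discrete ℕ ⥤ C) ⥤ C).Additive := Functor.additive_of_preserves_binary_products _
  have : (colim : (Discrete ℕ ⥤ C) ⥤ C).PreservesHomology := inferInstance
  rw [quasiIso_iff]
  intro n
  have h1 : QuasiIsoAt (totMap t) n := inferInstance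
  rw [quasiIsoAt_iff] at h1 ⊢
  exact ShortComplex.quasiIso_map_of_preservesLeftHomology (colim : (Discrete ℕ ⥤ C) ⥤ C)
    ((HomologicalComplex.shortComplexFunctor _ _ n).map (totMap t))

def ιX (K : ℕ → CochainComplex C ℤ) (i : ℕ) (n : ℤ) : (K i).X n ⟶ (cop K).X n :=
  colimit.ι ((tot K).X n) ⟨i⟩

def descX (K : ℕ → CochainComplex C ℤ) (n : ℤ) {T : C} (f : ∀ i, (K i).X n ⟶ T) :
    (cop K).X n ⟶ T :=
  colimit.desc ((tot K).X n) ⟨T, Discrete.natTrans (fun i => f i.as)⟩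

lemma ιX_descX (K : ℕ → CochainComplex C ℤ) (n : ℤ) {T : C} (f : ∀ i, (K i).X n ⟶ T) (i : ℕ) :
    ιX K i n ≫ descX K n f = f i :=
  colimit.ι_desc _ _

lemma ιX_descX_assoc (K : ℕ → CochainComplex C ℤ) (n : ℤ) {T : C} (f : ∀ i, (K i).X n ⟶ T)
    (i : ℕ) {U : C} (g : T ⟶ U) : ιX K i n ≫ descX K n f ≫ g = f i ≫ g := by
  rw [← Category.assoc, ιX_descX]

lemma X_ext (K : ℕ → CochainComplex C ℤ) (n : ℤ) {T : C} (f g : (cop K).X n ⟶ T)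
    (h : ∀ i, ιX K i n ≫ f = ιX K i n ≫ g) : f = g :=
  colimit.hom_ext (F := (tot K).X n) (fun i => h i.as)

lemma ιX_d (K : ℕ → CochainComplex C ℤ) (i : ℕ) (m n : ℤ) :
    ιX K i m ≫ (cop K).d m n = (K i).d m n ≫ ιX K i n :=
  ι_colimMap _ _

lemma ιX_map {K L : ℕ → CochainComplex C ℤ} (t : ∀ i, K i ⟶ L i) (i : ℕ) (n : ℤ) :
    ιX K i n ≫ (copMap t).f n = (t i).f n ≫ ιX L i n :=
  ι_colimMap _ _

def ι (K : ℕ → CochainComplex C ℤ) (i : ℕ) : K i ⟶ cop K where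
  f n := ιX K i n
  comm' m n _ := ιX_d K i m n

def desc (K : ℕ → CochainComplex C ℤ) {T : CochainComplex C ℤ} (f : ∀ i, K i ⟶ T) :
    cop K ⟶ T where
  f n := descX K n (fun i => (f i).f n)
  comm' m n _ := by
    apply X_ext
    intro i
    rw [ιX_descX_assoc, ← Category.assoc, ιX_d, Category.assoc, ιX_descX, (f i).comm]

lemma ι_desc (K : ℕ → CochainComplex C ℤ) {T : CochainComplex C ℤ} (f : ∀ i, K i ⟶ T) (i : ℕ) :
    ι K i ≫ desc K f = f i := by
  ext n
  exact ιX_descX K n (fun i => (f i).f n) i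

lemma ι_map {K L : ℕ → CochainComplex C ℤ} (t : ∀ i, K i ⟶ L i) (i : ℕ) :
    ι K i ≫ copMap t = t i ≫ ι L i := by
  ext n
  exact ιX_map _ _ _

def homotopyZero (K : ℕ → CochainComplex C ℤ) {T : CochainComplex C ℤ} (f : cop K ⟶ T)
    (h : ∀ i, Homotopy (ι K i ≫ f) 0) : Homotopy f 0 where
  hom m n := descX K m (fun i => (h i).hom m n)
  zero m n hmn := by
    apply X_ext
    intro i
    rw [ιX_descX, (h i).zero m n hmn, comp_zero]
  comm n := by
    apply X_ext
    intro i
    have := (h i).comm n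
    simp only [HomologicalComplex.comp_f, HomologicalComplex.zero_f, add_zero] at this ⊢
    erw [this]
    rw [dNext_eq _ (show (ComplexShape.up ℤ).Rel n (n+1) from rfl),
      dNext_eq _ (show (ComplexShape.up ℤ).Rel n (n+1) from rfl),
      prevD_eq _ (show (ComplexShape.up ℤ).Rel (n-1) n by simp),
      prevD_eq _ (show (ComplexShape.up ℤ).Rel (n-1) n by simp)]
    rw [Preadditive.comp_add, ← Category.assoc, ιX_d, Category.assoc, ιX_descX, ιX_descX_assoc]

open DerivedCategory

variable [HasDerivedCategory.{w} C]

lemma exists_homotopy {K L : CochainComplex C ℤ} (f : K ⟶ L) (h : Q.map f = 0) :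
    ∃ (K' : CochainComplex C ℤ) (t : K' ⟶ K), QuasiIso t ∧ Nonempty (Homotopy (t ≫ f) 0) := by
  have h1 : Qh.map ((HomotopyCategory.quotient _ _).map f) = Qh.map 0 := by
    rw [← cancel_mono ((quotientCompQhIso C).hom.app L), quotientCompQhIso_hom_naturality, h]
    simp
  rw [MorphismProperty.map_eq_iff_precomp Qh (HomotopyCategory.quasiIso C _)] at h1
  obtain ⟨X', s, hs, e⟩ := h1
  obtain ⟨X', rfl⟩ := HomotopyCategory.quotient_obj_surjective X'
  obtain ⟨s, rfl⟩ := (HomotopyCategory.quotient _ _).map_surjective s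
  refine ⟨X', s, ?_, ?_⟩
  · exact (HomotopyCategory.quotient_map_mem_quasiIso_iff s).1 hs
  · rw [← HomotopyCategory.quotient_map_eq_zero_iff, Functor.map_comp, e, comp_zero]

lemma existsDesc (K : ℕ → CochainComplex C ℤ) {T : DerivedCategory C}
    (f : ∀ i, Q.obj (K i) ⟶ T) : ∃ g : Q.obj (cop K) ⟶ T, ∀ i, Q.map (ι K i) ≫ g = f i := by
  let e := Q.objObjPreimageIso T
  choose K' s hs g hg using fun i => right_fac (f i ≫ e.inv)
  have := quasiIso_copMap s (fun i => (isIso_Q_map_iff_quasiIso C _).1 (hs i))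
  refine ⟨inv (Q.map (copMap s)) ≫ Q.map (desc K' g) ≫ e.hom, fun i => ?_⟩
  have h1 : Q.map (ι K i) ≫ inv (Q.map (copMap s)) = inv (Q.map (s i)) ≫ Q.map (ι K' i) := by
    rw [IsIso.comp_inv_eq, Category.assoc, IsIso.eq_inv_comp, ← Q.map_comp, ← Q.map_comp, ι_map]
  rw [reassoc_of% h1, ← Q.map_comp_assoc, ι_desc, ← Category.assoc, ← hg i]
  simp

lemma eqZero (K : ℕ → CochainComplex C ℤ) {T : DerivedCategory C}
    (f : Q.obj (cop K) ⟶ T) (h : ∀ i, Q.map (ι K i) ≫ f = 0) : f = 0 := by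
  let e := Q.objObjPreimageIso T
  rw [← cancel_mono e.inv, zero_comp]
  obtain ⟨T', g, s, hs, hg⟩ := left_fac (f ≫ e.inv)
  have h2 : ∀ i, Q.map (ι K i ≫ g) = 0 := by
    intro i
    rw [← cancel_mono (inv (Q.map s)), Q.map_comp, Category.assoc, ← hg, reassoc_of% h i]
    simp
  choose K' t ht ho using fun i => exists_homotopy _ (h2 i)
  have := quasiIso_copMap t ht
  have h3 : Homotopy (copMap t ≫ g) 0 := homotopyZero _ _ (fun i =>
    (Homotopy.ofEq (by rw [← Category.assoc, ι_map, Category.assoc])).trans (ho i).some)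
  have h4 := Q_map_eq_of_homotopy C h3
  rw [Q.map_comp, Functor.map_zero] at h4
  have h5 : Q.map g = 0 := (Preadditive.IsIso.comp_left_eq_zero _ _).1 h4
  rw [hg, h5, zero_comp]

lemma hasCoprod : HasCoproductsOfShape ℕ (DerivedCategory C) := by
  have key : ∀ X : ℕ → DerivedCategory C, HasCoproduct X := by
    intro X
    let K : ℕ → CochainComplex C ℤ := fun i => Q.objPreimage (X i)
    let e : ∀ i, Q.obj (K i) ≅ X i := fun i => Q.objObjPreimageIso (X i)
    let c : Cofan X := Cofan.mk (Q.obj (cop K)) (fun i => (e i).inv ≫ Q.map (ι K i))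
    have hex := fun (s : Cofan X) => existsDesc K (fun i => (e i).hom ≫ s.inj i)
    choose d hd using hex
    refine HasColimit.mk ⟨c, Cofan.IsColimit.mk c d ?_ ?_⟩
    · intro s i
      change ((e i).inv ≫ Q.map (ι K i)) ≫ d s = _
      rw [Category.assoc, hd]
      simp
    · intro s m hm
      rw [← sub_eq_zero]
      apply eqZero
      intro i
      have : ((e i).inv ≫ Q.map (ι K i)) ≫ m = _ := hm i
      rw [Category.assoc, Iso.inv_comp_eq] at this
      rw [Preadditive.comp_sub, hd, this, sub_self]
  constructor
  intro F
  have := key (fun i => F.obj ⟨i⟩)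
  exact hasColimit_of_iso (Discrete.natIsoFunctor (F := F))

end

end Stmt5Aux

universe v in
instance Stmt5Aux.exactMod (R : Type) [CommRing R] :
    HasExactColimitsOfShape (Discrete ℕ) (ModuleCat.{v} R) :=
  HasExactColimitsOfShape.domain_of_functor (Discrete ℕ)
    (forget₂ (ModuleCat.{v} R) AddCommGrpCat.{v})

/-- Let `S` be a class of objects of `D(R)` closed under isomorphism,
suspension, extensions and countable coproducts. If `X ∈ S` and `X ≅ A ⊞ B`, then
`A ∈ S`; that is, `S` is closed under direct summands (retracts). -/
theorem stmt5 (R : Type) [CommRing R] [IsNoetherianRing R]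
    [HasDerivedCategory.{w} (ModuleCat R)]
    (S : Set (DerivedCategory (ModuleCat R)))
    (hiso : ∀ ⦃X Y : DerivedCategory (ModuleCat R)⦄, (X ≅ Y) → X ∈ S → Y ∈ S)
    (hshift : ∀ ⦃X : DerivedCategory (ModuleCat R)⦄, X ∈ S → X⟦(1 : ℤ)⟧ ∈ S)
    (hext : ∀ ⦃X Y Z : DerivedCategory (ModuleCat R)⦄ (f : X ⟶ Y) (g : Y ⟶ Z)
      (h : Z ⟶ X⟦(1 : ℤ)⟧),
      (Triangle.mk f g h ∈ distTriang (DerivedCategory (ModuleCat R))) →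
      X ∈ S → Z ∈ S → Y ∈ S)
    (hcoprod : ∀ (X : ℕ → DerivedCategory (ModuleCat R)) (c : Cofan X),
      IsColimit c → (∀ i, X i ∈ S) → c.pt ∈ S)
    (X A B : DerivedCategory (ModuleCat R)) (hX : X ∈ S) (e : X ≅ A ⊞ B) :
    A ∈ S := by
  have : HasCoproductsOfShape ℕ (DerivedCategory (ModuleCat R)) := Stmt5Aux.hasCoprod
  have hX' : (A ⊞ B) ∈ S := hiso e hX
  let F : ℕ → DerivedCategory (ModuleCat R) := fun _ => A ⊞ B
  have hZ : (∐ F) ∈ S := hcoprod F _ (coproductIsCoproduct F) (fun _ => hX')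
  let c : Cofan F := Cofan.mk ((∐ F) ⊞ A) (fun i => biprod.desc
    (match i with
      | 0 => biprod.inr
      | j + 1 => biprod.inl ≫ Sigma.ι F j ≫ biprod.inl)
    (biprod.inr ≫ Sigma.ι F i ≫ biprod.inl))
  have hc : IsColimit c := by
    refine Cofan.IsColimit.mk c (fun s => biprod.desc
      (Sigma.desc (fun i => biprod.desc (biprod.inl ≫ s.inj (i+1)) (biprod.inr ≫ s.inj i)))
      (biprod.inl ≫ s.inj 0)) ?_ ?_
    · rintro s (_ | i) <;> apply biprod.hom_ext' <;> simp [c, F]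
    · intro s m hm
      apply biprod.hom_ext'
      · apply Sigma.hom_ext
        intro i
        apply biprod.hom_ext'
        · have := biprod.inl ≫= hm (i+1)
          simpa [c, F] using this
        · have := biprod.inr ≫= hm i
          simpa [c, F] using this
      · have := biprod.inl ≫= hm 0
        simpa [c, F] using this
  have hZA : ((∐ F) ⊞ A) ∈ S := hcoprod F c hc (fun _ => hX')
  exact hext _ _ _ (rot_of_distTriang _ (binaryBiproductTriangle_distinguished (∐ F) A))
    hZA (hshift hZ)
end

section
/- Let R be a commutative Noetherian ring and B an arbitrary R-module. Let S be any cocomplete preaisle in D(R) that contains R/p (concentrated in homological degree 0) for every prime p in the specialization closure of Ass B. Then B (concentrated in homological degree 0) lies in S. -/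
open CategoryTheory CategoryTheory.Limits CategoryTheory.Pretriangulated

universe w

section Cop
variable {R : Type} [CommRing R] {ι : Type} 

noncomputable def copPi {C : Type*} [Category C] [HasZeroMorphisms C]
    (X : ι → C) [HasCoproduct X] (i : ι) : ∐ X ⟶ X i := by
  classical exact Sigma.desc (fun j => if h : j = i then eqToHom (by rw [h]) else 0)

lemma copι_copPi {C : Type*} [Category C] [HasZeroMorphisms C]
    (X : ι → C) [HasCoproduct X] (i : ι) : Sigma.ι X i ≫ copPi X i = 𝟙 _ := by
  simp [copPi]

lemma copι_copPi_ne {C : Type*} [Category C] [HasZeroMorphisms C]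
    (X : ι → C) [HasCoproduct X] (i j : ι) (h : j ≠ i) : Sigma.ι X j ≫ copPi X i = 0 := by
  simp [copPi, h]

lemma cop_X_sum (X : ι → CochainComplex (ModuleCat.{0} R) ℤ) (n : ℤ) (x : (∐ X).X n) :
    ∃ s : Finset ι, x = ∑ i ∈ s, ((copPi X i ≫ Sigma.ι X i).f n).hom x := by
  classical
  let N : Submodule R ((∐ X).X n) :=
    { carrier := {x | ∃ s : Finset ι, ∀ t, s ⊆ t →
        x = ∑ i ∈ t, ((copPi X i ≫ Sigma.ι X i).f n).hom x}
      zero_mem' := ⟨∅, by simp⟩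
      add_mem' := by
        rintro a b ⟨s, hs⟩ ⟨t, ht⟩
        refine ⟨s ∪ t, fun u hu => ?_⟩
        simp only [map_add, Finset.sum_add_distrib]
        rw [← hs u (Finset.union_subset_left hu), ← ht u (Finset.union_subset_right hu)]
      smul_mem' := by
        rintro r a ⟨s, hs⟩
        refine ⟨s, fun u hu => ?_⟩
        simp only [map_smul, ← Finset.smul_sum]
        rw [← hs u hu] }
  have hN : ∀ j (y : (X j).X n), ((Sigma.ι X j).f n).hom y ∈ N := by
    intro j y
    refine ⟨{j}, fun t ht => ?_⟩
    have hc : ∀ i, ((copPi X i ≫ Sigma.ι X i).f n).hom (((Sigma.ι X j).f n).hom y)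
        = ((Sigma.ι X j ≫ copPi X i ≫ Sigma.ι X i).f n).hom y := fun i => rfl
    simp only [hc]
    rw [Finset.sum_eq_single j]
    · rw [← Category.assoc, copι_copPi, Category.id_comp]
    · intro i _ hi
      rw [← Category.assoc, copι_copPi_ne _ _ _ hi.symm]; simp
    · intro h; exact absurd (ht (Finset.mem_singleton_self j)) h
  have hc := isColimitOfPreserves (HomologicalComplex.eval (ModuleCat.{0} R) (ComplexShape.up ℤ) n)
    (colimit.isColimit (Discrete.functor X))
  have : ModuleCat.ofHom N.mkQ = 0 := by
    apply hc.hom_ext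
    rintro ⟨j⟩
    ext y
    have := (Submodule.Quotient.mk_eq_zero N).2 (hN j y)
    exact this
  have h2 : x ∈ N := by
    have := congr($(this).hom x)
    simpa using this
  obtain ⟨s, hs⟩ := h2
  exact ⟨s, hs s subset_rfl⟩

lemma cop_H_sum (X : ι → CochainComplex (ModuleCat.{0} R) ℤ) (n : ℤ) (x : (∐ X).homology n) :
    ∃ s : Finset ι, x = ∑ i ∈ s,
      (HomologicalComplex.homologyMap (copPi X i ≫ Sigma.ι X i) n).hom x := by
  obtain ⟨z, rfl⟩ := (ModuleCat.epi_iff_surjective ((∐ X).homologyπ n)).1 inferInstance x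
  obtain ⟨s, hs⟩ := cop_X_sum X n (((∐ X).iCycles n).hom z)
  refine ⟨s, ?_⟩
  have hz : z = ∑ i ∈ s, (HomologicalComplex.cyclesMap (copPi X i ≫ Sigma.ι X i) n).hom z := by
    apply (ModuleCat.mono_iff_injective ((∐ X).iCycles n)).1 inferInstance
    refine hs.trans ?_
    rw [map_sum]
    refine Finset.sum_congr rfl fun i _ => ?_
    exact congr($(HomologicalComplex.cyclesMap_i (copPi X i ≫ Sigma.ι X i) n).hom z).symm
  conv_lhs => rw [hz]
  rw [map_sum]
  refine Finset.sum_congr rfl fun i _ => ?_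
  exact congr($(HomologicalComplex.homologyπ_naturality (copPi X i ≫ Sigma.ι X i) n).hom z).symm

lemma cop_H_ext (X : ι → CochainComplex (ModuleCat.{0} R) ℤ) (n : ℤ) {W : ModuleCat.{0} R}
    (f g : (∐ X).homology n ⟶ W)
    (h : ∀ i, HomologicalComplex.homologyMap (Sigma.ι X i) n ≫ f =
      HomologicalComplex.homologyMap (Sigma.ι X i) n ≫ g) : f = g := by
  ext x
  obtain ⟨s, hs⟩ := cop_H_sum X n x
  rw [hs, map_sum, map_sum]
  refine Finset.sum_congr rfl fun i _ => ?_
  rw [HomologicalComplex.homologyMap_comp]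
  exact congr($(h i).hom ((HomologicalComplex.homologyMap (copPi X i) n).hom x))

lemma cop_quasiIso (X Y : ι → CochainComplex (ModuleCat.{0} R) ℤ) (s : ∀ i, X i ⟶ Y i)
    [∀ i, QuasiIso (s i)] : QuasiIso (Limits.Sigma.map s) := by
  rw [quasiIso_iff]
  intro n
  rw [quasiIsoAt_iff_isIso_homologyMap]
  have hm : Mono (HomologicalComplex.homologyMap (Limits.Sigma.map s) n) := by
    rw [ModuleCat.mono_iff_injective]
    refine (injective_iff_map_eq_zero _).2 fun x hx => ?_
    obtain ⟨t, ht⟩ := cop_H_sum X n x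
    rw [ht]
    refine Finset.sum_eq_zero fun i _ => ?_
    have key : (HomologicalComplex.homologyMap (copPi X i) n).hom x = 0 := by
      have h1 : copPi X i ≫ s i = Limits.Sigma.map s ≫ copPi Y i := by
        apply Sigma.hom_ext
        intro j
        rw [Sigma.ι_map_assoc]
        by_cases h : j = i
        · subst h
          rw [← Category.assoc, copι_copPi, copι_copPi]; simp
        · rw [← Category.assoc, copι_copPi_ne _ _ _ h, copι_copPi_ne _ _ _ h]; simp
      apply (ModuleCat.mono_iff_injective (HomologicalComplex.homologyMap (s i) n)).1 inferInstance
      have h2 := congr((HomologicalComplex.homologyMap $h1 n).hom x)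
      rw [HomologicalComplex.homologyMap_comp, HomologicalComplex.homologyMap_comp] at h2
      refine h2.trans ?_
      refine (congrArg (HomologicalComplex.homologyMap (copPi Y i) n).hom hx).trans ?_
      rw [map_zero, map_zero]
    rw [HomologicalComplex.homologyMap_comp]
    refine (congrArg (HomologicalComplex.homologyMap (Sigma.ι X i) n).hom key).trans ?_
    rw [map_zero]
  have he : Epi (HomologicalComplex.homologyMap (Limits.Sigma.map s) n) := by
    constructor
    intro W f g hfg
    apply cop_H_ext
    intro i
    rw [← cancel_epi (HomologicalComplex.homologyMap (s i) n)]
    have h1 : HomologicalComplex.homologyMap (s i) n ≫ HomologicalComplex.homologyMap (Sigma.ι Y i) n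
        = HomologicalComplex.homologyMap (Sigma.ι X i) n ≫
          HomologicalComplex.homologyMap (Limits.Sigma.map s) n := by
      rw [← HomologicalComplex.homologyMap_comp, ← HomologicalComplex.homologyMap_comp, Sigma.ι_map]
    rw [reassoc_of% h1, reassoc_of% h1, hfg]
  exact isIso_of_mono_of_epi _
end Cop

section DCop
variable {R : Type} [CommRing R] [HasDerivedCategory.{w} (ModuleCat.{0} R)] {ι : Type} 
open DerivedCategory

lemma Qcop_H_ext (X : ι → CochainComplex (ModuleCat.{0} R) ℤ) (n : ℤ) {W : ModuleCat.{0} R}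
    (f g : (homologyFunctor _ n).obj (Q.obj (∐ X)) ⟶ W)
    (h : ∀ i, (homologyFunctor _ n).map (Q.map (Sigma.ι X i)) ≫ f =
      (homologyFunctor _ n).map (Q.map (Sigma.ι X i)) ≫ g) : f = g := by
  rw [← cancel_epi ((homologyFunctorFactors (ModuleCat.{0} R) n).inv.app (∐ X))]
  apply cop_H_ext
  intro i
  have h1 := (homologyFunctorFactors (ModuleCat.{0} R) n).inv.naturality (Sigma.ι X i)
  have h2 := congr($h1 ≫ f)
  have h3 := congr($h1 ≫ g)
  rw [Category.assoc, Category.assoc] at h2 h3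
  exact h2.trans (Eq.trans (congrArg _ (h i)) h3.symm)

lemma Qcop_exists (X : ι → CochainComplex (ModuleCat.{0} R) ℤ)
    (Z : DerivedCategory (ModuleCat.{0} R)) (f : ∀ i, Q.obj (X i) ⟶ Z) :
    ∃ g : Q.obj (∐ X) ⟶ Z, ∀ i, Q.map (Sigma.ι X i) ≫ g = f i := by
  let e := Q.objObjPreimageIso Z
  choose X' s hs a ha using fun i => right_fac (f i ≫ e.inv)
  have : ∀ i, QuasiIso (s i) := fun i => (isIso_Q_map_iff_quasiIso _ _).1 (hs i)
  have := cop_quasiIso _ _ s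
  refine ⟨inv (Q.map (Limits.Sigma.map s)) ≫ Q.map (Sigma.desc a) ≫ e.hom, fun i => ?_⟩
  have h1 : Q.map (Sigma.ι X i) ≫ inv (Q.map (Limits.Sigma.map s)) =
      inv (Q.map (s i)) ≫ Q.map (Sigma.ι X' i) := by
    rw [IsIso.comp_inv_eq, Category.assoc, IsIso.eq_inv_comp, ← Q.map_comp, ← Q.map_comp,
      Sigma.ι_map]
  rw [reassoc_of% h1, ← Q.map_comp_assoc, Sigma.ι_desc, ← Category.assoc, ← ha]
  simp

lemma Qcop_uniq (X : ι → CochainComplex (ModuleCat.{0} R) ℤ)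
    (Z : DerivedCategory (ModuleCat.{0} R)) (g : Q.obj (∐ X) ⟶ Z)
    (hg : ∀ i, Q.map (Sigma.ι X i) ≫ g = 0) : g = 0 := by
  obtain ⟨Y, p, d, hT⟩ := distinguished_cocone_triangle₁ g
  choose h hh using fun i => Triangle.coyoneda_exact₂ _ hT (Q.map (Sigma.ι X i)) (hg i)
  obtain ⟨k, hk⟩ := Qcop_exists X Y h
  have : IsIso (k ≫ p) := by
    rw [isIso_iff]
    intro n
    have : (homologyFunctor (ModuleCat.{0} R) n).map (k ≫ p) = 𝟙 _ := by
      apply Qcop_H_ext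
      intro i
      rw [← Functor.map_comp, reassoc_of% hk i]
      simp only [Category.comp_id]
      exact congrArg _ (hh i).symm
    rw [this]; infer_instance
  rw [← cancel_epi (k ≫ p), comp_zero, Category.assoc]
  have h0 : p ≫ g = 0 := comp_distTriang_mor_zero₁₂ _ hT
  rw [h0, comp_zero]

noncomputable def QcopIsColimit (X : ι → CochainComplex (ModuleCat.{0} R) ℤ) :
    IsColimit (Cofan.mk (Q.obj (∐ X)) (fun i => Q.map (Sigma.ι X i))) :=
  Cofan.IsColimit.mk _ (fun c => (Qcop_exists X c.pt c.inj).choose)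
    (fun c i => (Qcop_exists X c.pt c.inj).choose_spec i)
    (fun c m hm => by
      rw [← sub_eq_zero]
      apply Qcop_uniq
      intro i
      rw [Preadditive.comp_sub, (Qcop_exists X c.pt c.inj).choose_spec i, sub_eq_zero]
      exact hm i)

instance Q_pres : PreservesColimitsOfShape (Discrete ι)
    (Q : CochainComplex (ModuleCat.{0} R) ℤ ⥤ _) := by
  have : ∀ X : ι → CochainComplex (ModuleCat.{0} R) ℤ,
      PreservesColimit (Discrete.functor X) 
        (Q : CochainComplex (ModuleCat.{0} R) ℤ ⥤ _) := fun X =>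
    preservesColimit_of_preserves_colimit_cocone (coproductIsCoproduct X)
      ((isColimitMapCoconeCofanMkEquiv Q X _).symm (QcopIsColimit X))
  exact preservesColimitsOfShape_of_discrete _

instance D_cop : HasColimitsOfShape (Discrete ι) (DerivedCategory (ModuleCat.{0} R)) := by
  have : ∀ Z : ι → DerivedCategory (ModuleCat.{0} R), HasCoproduct Z := fun Z => by
    have : HasCoproduct (fun i => Q.obj (Q.objPreimage (Z i))) :=
      ⟨⟨_, QcopIsColimit (fun i => Q.objPreimage (Z i))⟩⟩
    exact hasColimit_of_iso (F := Discrete.functor (fun i => Q.obj (Q.objPreimage (Z i))))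
      (Discrete.natIso (fun i => (Q.objObjPreimageIso (Z i.as)).symm))
  exact ⟨fun F => hasColimit_of_iso (Discrete.natIsoFunctor (F := F))⟩

lemma D_H_ext (Z : ι → DerivedCategory (ModuleCat.{0} R)) (n : ℤ) {W : ModuleCat.{0} R}
    (f g : (homologyFunctor _ n).obj (∐ Z) ⟶ W)
    (h : ∀ i, (homologyFunctor _ n).map (Sigma.ι Z i) ≫ f =
      (homologyFunctor _ n).map (Sigma.ι Z i) ≫ g) : f = g := by
  let X := fun i => Q.objPreimage (Z i)
  let u : Q.obj (∐ X) ⟶ ∐ Z := (QcopIsColimit X).desc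
    (Cofan.mk _ (fun i => (Q.objObjPreimageIso (Z i)).hom ≫ Sigma.ι Z i))
  have hu : ∀ i, Q.map (Sigma.ι X i) ≫ u = (Q.objObjPreimageIso (Z i)).hom ≫ Sigma.ι Z i :=
    fun i => (QcopIsColimit X).fac _ ⟨i⟩
  let v : ∐ Z ⟶ Q.obj (∐ X) :=
    Sigma.desc (fun i => (Q.objObjPreimageIso (Z i)).inv ≫ Q.map (Sigma.ι X i))
  have hvu : v ≫ u = 𝟙 _ := by
    apply Sigma.hom_ext
    intro i
    simp [v, hu]
  have : Epi ((homologyFunctor (ModuleCat.{0} R) n).map u) :=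
    (SplitEpi.mk ((homologyFunctor (ModuleCat.{0} R) n).map v)
      (by rw [← Functor.map_comp, hvu]; simp)).epi
  rw [← cancel_epi ((homologyFunctor (ModuleCat.{0} R) n).map u)]
  apply Qcop_H_ext
  intro i
  rw [← Functor.map_comp_assoc, ← Functor.map_comp_assoc, hu]
  simp [h]

instance single_pres (n : ℤ) : PreservesColimitsOfShape (Discrete ι)
    (singleFunctor (ModuleCat.{0} R) n) :=
  have : PreservesColimitsOfShape (Discrete ι) (CochainComplex.singleFunctor (ModuleCat.{0} R) n) :=
    inferInstanceAs (PreservesColimitsOfShape (Discrete ι)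
      (HomologicalComplex.single (ModuleCat.{0} R) (ComplexShape.up ℤ) n))
  preservesColimitsOfShape_of_natIso (F := CochainComplex.singleFunctor (ModuleCat.{0} R) n ⋙ Q)
    (singleFunctorIsoCompQ (ModuleCat.{0} R) n).symm
end DCop

set_option linter.unusedSectionVars false
section Tri
variable {C : Type*} [Category C] [HasZeroObject C] [HasShift C ℤ] [Preadditive C]
  [∀ n : ℤ, (shiftFunctor C n).Additive] [Pretriangulated C]

lemma dist_iso {X Y Z X' Y' Z' : C} {f : X ⟶ Y} {g : Y ⟶ Z} {h : Z ⟶ X⟦(1 : ℤ)⟧}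
    (hT : Triangle.mk f g h ∈ distTriang C)
    {f' : X' ⟶ Y'} {g' : Y' ⟶ Z'} {h' : Z' ⟶ X'⟦(1 : ℤ)⟧}
    (a : X' ≅ X) (b : Y' ≅ Y) (c : Z' ≅ Z) (h1 : f' ≫ b.hom = a.hom ≫ f)
    (h2 : g' ≫ c.hom = b.hom ≫ g) (h3 : h' ≫ a.hom⟦(1 : ℤ)⟧' = c.hom ≫ h) :
    Triangle.mk f' g' h' ∈ distTriang C :=
  isomorphic_distinguished _ hT _ (Triangle.isoMk _ _ a b c h1 h2 h3)

lemma copShift_desc {ι : Type} [HasColimitsOfShape (Discrete ι) C] (X : ι → C) (W : C)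
    (b : ∀ i, (X i)⟦(1 : ℤ)⟧ ⟶ W) :
    ∃ g : (∐ X)⟦(1 : ℤ)⟧ ⟶ W, ∀ i, (Sigma.ι X i)⟦(1 : ℤ)⟧' ≫ g = b i := by
  have hc := isColimitCofanMkObjOfIsColimit (shiftFunctor C (1 : ℤ)) _ _ (coproductIsCoproduct X)
  exact ⟨hc.desc (Cofan.mk W b), fun i => hc.fac (Cofan.mk W b) ⟨i⟩⟩

lemma copShift_ext {ι : Type} [HasColimitsOfShape (Discrete ι) C] (X : ι → C) (W : C)
    (f g : (∐ X)⟦(1 : ℤ)⟧ ⟶ W)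
    (h : ∀ i, (Sigma.ι X i)⟦(1 : ℤ)⟧' ≫ f = (Sigma.ι X i)⟦(1 : ℤ)⟧' ≫ g) : f = g := by
  have hc := isColimitCofanMkObjOfIsColimit (shiftFunctor C (1 : ℤ)) _ _ (coproductIsCoproduct X)
  exact hc.hom_ext (fun ⟨i⟩ => h i)

lemma copTri {ι : Type} [HasColimitsOfShape (Discrete ι) C] (X M T : ι → C)
    (x : ∀ i, X i ⟶ M i) (t : ∀ i, M i ⟶ T i) (d : ∀ i, T i ⟶ (X i)⟦(1 : ℤ)⟧)
    (hT : ∀ i, Triangle.mk (x i) (t i) (d i) ∈ distTriang C) :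
    ∃ δ, Triangle.mk (Limits.Sigma.map x) (Limits.Sigma.map t) δ ∈ distTriang C := by
  obtain ⟨Z, f₂, f₃, hZ⟩ := distinguished_cocone_triangle (Limits.Sigma.map x)
  choose φ hφ1 hφ2 using fun i => complete_distinguished_triangle_morphism _ _ (hT i) hZ
    (Sigma.ι X i) (Sigma.ι M i) (Sigma.ι_map x i).symm
  change ∀ i, T i ⟶ Z at φ
  change ∀ i, t i ≫ φ i = Sigma.ι M i ≫ f₂ at hφ1
  change ∀ i, d i ≫ (Sigma.ι X i)⟦(1 : ℤ)⟧' = φ i ≫ f₃ at hφ2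
  let Φ : ∐ T ⟶ Z := Sigma.desc φ
  have hΦ : ∀ i, Sigma.ι T i ≫ Φ = φ i := fun i => by simp [Φ]
  have htΦ : Limits.Sigma.map t ≫ Φ = f₂ := by
    apply Sigma.hom_ext
    intro i
    rw [Sigma.ι_map_assoc, hΦ, hφ1]
  have z31 : f₃ ≫ (Limits.Sigma.map x)⟦(1 : ℤ)⟧' = 0 := comp_distTriang_mor_zero₃₁ _ hZ
  have hb : ∀ W : C, Function.Bijective (fun a : Z ⟶ W => Φ ≫ a) := by
    intro W
    constructor
    · intro a₁ a₂ h12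
      rw [← sub_eq_zero]
      have h0 : Φ ≫ (a₁ - a₂) = 0 := by
        rw [Preadditive.comp_sub, sub_eq_zero]; exact h12
      generalize a₁ - a₂ = a at h0
      obtain ⟨b, hb⟩ := Triangle.yoneda_exact₃ _ hZ a (show f₂ ≫ a = 0 by
        rw [← htΦ, Category.assoc, h0, comp_zero])
      change (∐ X)⟦(1 : ℤ)⟧ ⟶ W at b
      change a = f₃ ≫ b at hb
      have h1 : ∀ i, ∃ c : (M i)⟦(1 : ℤ)⟧ ⟶ W,
          (Sigma.ι X i)⟦(1 : ℤ)⟧' ≫ b = (-(x i)⟦(1 : ℤ)⟧') ≫ c := by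
        intro i
        refine Triangle.yoneda_exact₃ _ (rot_of_distTriang _ (hT i)) _ ?_
        change d i ≫ _ = 0
        rw [← Category.assoc, hφ2, Category.assoc, ← hb, ← hΦ, Category.assoc, h0, comp_zero]
      choose c hc using h1
      obtain ⟨c', hc'⟩ := copShift_desc M W c
      have h2 : b = - ((Limits.Sigma.map x)⟦(1 : ℤ)⟧' ≫ c') := by
        apply copShift_ext
        intro i
        rw [hc, Preadditive.comp_neg, ← Functor.map_comp_assoc, Sigma.ι_map, Functor.map_comp,
          Category.assoc, hc', Preadditive.neg_comp]
      rw [hb, h2, Preadditive.comp_neg, ← Category.assoc, z31, zero_comp, neg_zero]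
    · intro c
      have z : Limits.Sigma.map x ≫ Limits.Sigma.map t = 0 := by
        apply Sigma.hom_ext
        intro i
        have : x i ≫ t i = 0 := comp_distTriang_mor_zero₁₂ _ (hT i)
        rw [Sigma.ι_map_assoc, Sigma.ι_map, reassoc_of% this]; simp
      have z2 : Limits.Sigma.map x ≫ Limits.Sigma.map t ≫ c = 0 := by
        rw [← Category.assoc, z, zero_comp]
      obtain ⟨a, ha⟩ : ∃ a : Z ⟶ W, Limits.Sigma.map t ≫ c = f₂ ≫ a :=
        Triangle.yoneda_exact₂ _ hZ (Limits.Sigma.map t ≫ c) z2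
      have h1 : ∀ i, ∃ b : (X i)⟦(1 : ℤ)⟧ ⟶ W, Sigma.ι T i ≫ (c - Φ ≫ a) = d i ≫ b := by
        intro i
        refine Triangle.yoneda_exact₃ _ (hT i) _ ?_
        change t i ≫ _ = 0
        rw [← Sigma.ι_map_assoc, Preadditive.comp_sub, ha, ← Category.assoc _ Φ, htΦ, sub_self,
          comp_zero]
      choose b hb using h1
      obtain ⟨b', hb'⟩ := copShift_desc X W b
      refine ⟨a + f₃ ≫ b', ?_⟩
      dsimp
      rw [Preadditive.comp_add, ← eq_sub_iff_add_eq']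
      apply Sigma.hom_ext
      intro i
      rw [hb, ← Category.assoc, hΦ, ← Category.assoc, ← hφ2, Category.assoc, hb']
  have : IsIso Φ := by
    rw [isIso_iff_coyoneda_map_bijective]
    intro W
    exact hb W
  exact ⟨Φ ≫ f₃, dist_iso hZ (Iso.refl _) (Iso.refl _) (asIso Φ) (by simp) (by simp [htΦ]) (by simp)⟩

lemma cone_tele [HasColimitsOfShape (Discrete ℕ) C] (M Z : C)
    (g : (∐ fun _ : ℕ => M) ⟶ Z) (h)
    (hT : Triangle.mk (𝟙 (∐ fun _ : ℕ => M) - Sigma.desc (fun n => Sigma.ι (fun _ : ℕ => M) (n+1)))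
      g h ∈ distTriang C) : Nonempty (Z ≅ M) := by
  let I := Sigma.ι (fun _ : ℕ => M)
  let u := 𝟙 (∐ fun _ : ℕ => M) - Sigma.desc (fun n => I (n+1))
  have hu : ∀ n, I n ≫ u = I n - I (n+1) := fun n => by simp [I, u]
  let r : (∐ fun _ : ℕ => M) ⟶ ∐ fun _ : ℕ => M :=
    Sigma.desc (fun n => - ∑ k ∈ Finset.range n, I k)
  have hr : ∀ n, I n ≫ r = - ∑ k ∈ Finset.range n, I k := fun n => by simp [I, r]
  let p : (∐ fun _ : ℕ => M) ⟶ M := Sigma.desc (fun n => 𝟙 M)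
  have hp : ∀ n, I n ≫ p = 𝟙 M := fun n => by simp [I, p]
  have hur : u ≫ r = 𝟙 _ := by
    apply Sigma.hom_ext
    intro n
    change I n ≫ _ = I n ≫ _
    rw [← Category.assoc, hu, Preadditive.sub_comp, hr, hr, Finset.sum_range_succ]
    simp
  have hru : r ≫ u = 𝟙 _ - p ≫ I 0 := by
    apply Sigma.hom_ext
    intro n
    change I n ≫ _ = I n ≫ _
    rw [← Category.assoc, hr, Preadditive.comp_sub (I n), ← Category.assoc (I n), hp,
      Preadditive.neg_comp, Preadditive.sum_comp]
    simp only [hu, Category.id_comp, Category.comp_id]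
    rw [Finset.sum_range_sub']; simp
  have hup : u ≫ p = 0 := by
    apply Sigma.hom_ext
    intro n
    change I n ≫ _ = I n ≫ _
    rw [← Category.assoc, hu, Preadditive.sub_comp, hp, hp]; simp
  have hug : u ≫ g = 0 := comp_distTriang_mor_zero₁₂ _ hT
  have hh : h = 0 := by
    have h1 : h ≫ u⟦(1 : ℤ)⟧' = 0 := comp_distTriang_mor_zero₃₁ _ hT
    have h2 := congr($h1 ≫ r⟦(1 : ℤ)⟧')
    rwa [Category.assoc, ← Functor.map_comp, hur, CategoryTheory.Functor.map_id, Category.comp_id, zero_comp] at h2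
  have hg : Epi g := (Triangle.mor₃_eq_zero_iff_epi₂ _ hT).1 hh
  obtain ⟨q, hq⟩ := Triangle.yoneda_exact₂ _ hT p hup
  change Z ⟶ M at q
  change p = g ≫ q at hq
  refine ⟨⟨q, I 0 ≫ g, ?_, ?_⟩⟩
  · rw [← cancel_epi g, ← Category.assoc, ← hq, Category.comp_id, ← Category.assoc]
    have : p ≫ I 0 = 𝟙 _ - r ≫ u := by rw [hru]; simp
    rw [this, Preadditive.sub_comp, Category.assoc, hug]; simp
  · rw [Category.assoc, ← hq, hp]

lemma tele [IsTriangulated C] [HasColimitsOfShape (Discrete ℕ) C] (M : C) (T X : ℕ → C)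
    (t : ∀ n, T n ⟶ T (n+1)) (x : ∀ n, X n ⟶ M) (c : ∀ n, M ⟶ T n)
    (d : ∀ n, T n ⟶ (X n)⟦(1 : ℤ)⟧)
    (hT : ∀ n, Triangle.mk (x n) (c n) (d n) ∈ distTriang C)
    (hc : ∀ n, c (n+1) = c n ≫ t n)
    [IsIso (𝟙 (∐ T) - Sigma.desc (fun n => t n ≫ Sigma.ι T (n+1)))] :
    ∃ (f : ((∐ X)⟦(1 : ℤ)⟧)⟦(-1 : ℤ)⟧ ⟶ M) (g : M ⟶ (∐ X)⟦(1 : ℤ)⟧) (h : _),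
      Triangle.mk f g h ∈ distTriang C := by
  let w := 𝟙 (∐ T) - Sigma.desc (fun n => t n ≫ Sigma.ι T (n+1))
  have : IsIso w := by assumption
  let u := 𝟙 (∐ fun _ : ℕ => M) - Sigma.desc (fun n => Sigma.ι (fun _ : ℕ => M) (n+1))
  obtain ⟨δ, hδ⟩ := copTri X (fun _ => M) T x c d hT
  let v : (∐ fun _ : ℕ => M) ⟶ ∐ T := Limits.Sigma.map c
  have huv : u ≫ v = v ≫ w := by
    apply Sigma.hom_ext
    intro n
    simp [u, v, w, Preadditive.comp_sub, Preadditive.sub_comp, hc]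
  have h23 : Triangle.mk v δ (-(Limits.Sigma.map x)⟦(1 : ℤ)⟧') ∈ distTriang C :=
    rot_of_distTriang _ hδ
  have h13 : Triangle.mk (v ≫ w) (inv w ≫ δ) (-(Limits.Sigma.map x)⟦(1 : ℤ)⟧') ∈ distTriang C := by
    exact dist_iso h23 (Iso.refl _) (asIso w).symm (Iso.refl _) (by simp) (by simp) (by simp)
  obtain ⟨Z, g, h, hZ⟩ := distinguished_cocone_triangle u
  obtain ⟨e⟩ := cone_tele M Z g h hZ
  have o := Triangulated.someOctahedron huv hZ h23 h13
  have hm := inv_rot_of_distTriang _ o.mem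
  let A := (Triangle.mk o.m₁ o.m₃ ((-(Limits.Sigma.map x)⟦(1 : ℤ)⟧') ≫ g⟦(1 : ℤ)⟧')).invRotate
  obtain ⟨f0, g0, h0, hm⟩ : ∃ (f0 : ((∐ X)⟦(1:ℤ)⟧)⟦(-1:ℤ)⟧ ⟶ Z) (g0 : Z ⟶ (∐ X)⟦(1:ℤ)⟧)
      (h0 : (∐ X)⟦(1:ℤ)⟧ ⟶ (((∐ X)⟦(1:ℤ)⟧)⟦(-1:ℤ)⟧)⟦(1:ℤ)⟧),
      Triangle.mk f0 g0 h0 ∈ distTriang C := ⟨A.mor₁, A.mor₂, A.mor₃, hm⟩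
  exact ⟨f0 ≫ e.hom, e.inv ≫ g0, h0,
    dist_iso hm (Iso.refl _) e.symm (Iso.refl _) (by simp) (by simp) (by simp)⟩
end Tri

section P3
variable {R : Type} [CommRing R] [HasDerivedCategory.{w} (ModuleCat.{0} R)]
open DerivedCategory

lemma zero_memS {S : Set (DerivedCategory (ModuleCat R))} (hS : IsCocompletePreaisle R S)
    {X : DerivedCategory (ModuleCat R)} (hX : IsZero X) : X ∈ S := by
  have h := hS.coproduct_mem (ι := Empty) Empty.elim _ (coproductIsCoproduct _) (fun i => i.elim)
  refine hS.mem_of_iso (IsZero.iso ?_ hX) h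
  refine (IsZero.iff_id_eq_zero _).2 (Sigma.hom_ext _ _ (fun i => i.elim))

lemma fib_comp {S : Set (DerivedCategory (ModuleCat R))} (hS : IsCocompletePreaisle R S)
    {A B C X G Y : DerivedCategory (ModuleCat R)} {c : A ⟶ B} {t : B ⟶ C}
    {x : X ⟶ A} {d : B ⟶ X⟦(1 : ℤ)⟧} (h1 : Triangle.mk x c d ∈ distTriang _)
    {g : G ⟶ B} {e : C ⟶ G⟦(1 : ℤ)⟧} (h2 : Triangle.mk g t e ∈ distTriang _)
    {y : Y ⟶ A} {k : C ⟶ Y⟦(1 : ℤ)⟧} (h3 : Triangle.mk y (c ≫ t) k ∈ distTriang _)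
    (hX : X ∈ S) (hG : G ∈ S) : Y ∈ S := by
  obtain o := Triangulated.someOctahedron' (rfl : c ≫ t = c ≫ t) h1 h2 h3
  exact hS.ext_mem _ _ _ o.mem hX hG

noncomputable def compN {C : Type*} [Category C] (T : ℕ → C) (t : ∀ n, T n ⟶ T (n+1)) :
    ∀ n, T 0 ⟶ T n
  | 0 => 𝟙 _
  | n + 1 => compN T t n ≫ t n

lemma tower {S : Set (DerivedCategory (ModuleCat R))} (hS : IsCocompletePreaisle R S)
    (T G : ℕ → DerivedCategory (ModuleCat R)) (t : ∀ n, T n ⟶ T (n+1))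
    (g : ∀ n, G n ⟶ T n) (e : ∀ n, T (n+1) ⟶ (G n)⟦(1 : ℤ)⟧)
    (hT : ∀ n, Triangle.mk (g n) (t n) (e n) ∈ distTriang _) (hG : ∀ n, G n ∈ S)
    (h0 : ∀ i n, (homologyFunctor _ i).map (t n) = 0) : T 0 ∈ S := by
  choose X x d hX using fun n => distinguished_cocone_triangle₁ (compN T t n)
  have hXS : ∀ n, X n ∈ S := by
    intro n
    induction n with
    | zero =>
      apply zero_memS hS
      have := (Triangle.isZero₁_iff_isIso₂ _ (hX 0)).2
        (show IsIso (𝟙 (T 0)) by infer_instance)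
      exact this
    | succ n ih => exact fib_comp hS (hX n) (hT n) (hX (n+1)) ih (hG n)
  have : IsIso (𝟙 (∐ T) - Sigma.desc (fun n => t n ≫ Sigma.ι T (n+1))) := by
    rw [DerivedCategory.isIso_iff]
    intro i
    have : (homologyFunctor (ModuleCat R) i).map
        (Sigma.desc (fun n => t n ≫ Sigma.ι T (n+1))) = 0 := by
      apply D_H_ext
      intro n
      rw [← Functor.map_comp, Sigma.ι_desc, Functor.map_comp, h0, zero_comp, comp_zero]
    rw [Functor.map_sub, this, sub_zero, CategoryTheory.Functor.map_id]
    infer_instance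
  obtain ⟨f, g, h, hm⟩ := tele (T 0) T X t x (compN T t) d hX (fun n => rfl)
  have hc := hS.coproduct_mem X _ (coproductIsCoproduct X) hXS
  refine hS.ext_mem f g h hm (hS.mem_of_iso ?_ hc) (hS.shift_mem hc)
  exact (shiftShiftNeg (C := DerivedCategory (ModuleCat R)) (∐ X) (1 : ℤ)).symm

noncomputable abbrev Sh (X : DerivedCategory (ModuleCat R)) : DerivedCategory (ModuleCat R) := X⟦(1 : ℤ)⟧

lemma iter_mem {S : Set (DerivedCategory (ModuleCat R))} (hS : IsCocompletePreaisle R S)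
    (n : ℕ) : ∀ {X : DerivedCategory (ModuleCat R)}, X ∈ S → Sh^[n] X ∈ S := by
  induction n with
  | zero => exact fun h => h
  | succ n ih => exact fun h => ih (hS.shift_mem h)

lemma iter_tri (n : ℕ) : ∀ {X Y Z : DerivedCategory (ModuleCat R)} (f : X ⟶ Y) (g : Y ⟶ Z)
    (h : Z ⟶ X⟦(1 : ℤ)⟧), Triangle.mk f g h ∈ distTriang _ →
    ∃ (f' : Sh^[n] X ⟶ Sh^[n] Y) (g' : Sh^[n] Y ⟶ Sh^[n] Z)
      (h' : Sh^[n] Z ⟶ (Sh^[n] X)⟦(1 : ℤ)⟧), Triangle.mk f' g' h' ∈ distTriang _ := by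
  induction n with
  | zero => exact fun f g h hm => ⟨f, g, h, hm⟩
  | succ n ih =>
    intro X Y Z f g h hm
    exact ih _ _ _ (Triangle.shift_distinguished _ hm 1)

def Conc (n : ℤ) (X : DerivedCategory (ModuleCat R)) : Prop :=
  ∀ i, i ≠ n → IsZero ((homologyFunctor (ModuleCat R) i).obj X)

lemma conc_shift {n : ℤ} {X : DerivedCategory (ModuleCat R)} (h : Conc n X) :
    Conc (n-1) (Sh X) := by
  intro i hi
  refine IsZero.of_iso (h (1 + i) (by lia)) ?_
  exact ((homologyFunctor (ModuleCat R) 0).shiftIso 1 i (1+i) rfl).app X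

lemma conc_iter (n : ℕ) : ∀ {m : ℤ} {X : DerivedCategory (ModuleCat R)}, Conc m X →
    Conc (m-n) (Sh^[n] X) := by
  induction n with
  | zero => intro m X h; simpa using h
  | succ n ih => 
    intro m X h
    have := ih (conc_shift h)
    rwa [show m - 1 - (n : ℤ) = m - ((n+1 : ℕ) : ℤ) by push_cast; ring] at this

lemma conc_single (M : ModuleCat.{0} R) : Conc 0 ((singleFunctor _ 0).obj M) := by
  intro i hi
  rcases lt_or_gt_of_ne hi with h | h
  · exact isZero_of_isGE _ 0 i h
  · exact isZero_of_isLE _ 0 i h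

/-- the tower lemma for modules -/
lemma tower_mod {S : Set (DerivedCategory (ModuleCat R))} (hS : IsCocompletePreaisle R S)
    (K : ℕ → ShortComplex (ModuleCat.{0} R)) (hK : ∀ n, (K n).ShortExact)
    (h1 : ∀ n, (K n).X₁ = (K (n+1)).X₃)
    (h2 : ∀ n, (singleFunctor _ 0).obj (K n).X₂ ∈ S) :
    (singleFunctor _ 0).obj (K 0).X₃ ∈ S := by
  have h : ∀ n, ∃ (f : (singleFunctor _ 0).obj (K n).X₂ ⟶ (singleFunctor _ 0).obj (K n).X₃)
      (g : _ ⟶ ((singleFunctor _ 0).obj (K (n+1)).X₃)⟦(1 : ℤ)⟧) (h : _),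
      Triangle.mk f g h ∈ distTriang (DerivedCategory (ModuleCat R)) := by
    intro n
    rw [← h1]
    exact ⟨_, _, _, rot_of_distTriang _ (hK n).singleTriangle_distinguished⟩
  choose f g h hm using h
  choose f' g' h' hm' using fun n => iter_tri n _ _ _ (hm n)
  refine tower hS (fun n => Sh^[n] ((singleFunctor _ 0).obj (K n).X₃))
    (fun n => Sh^[n] ((singleFunctor _ 0).obj (K n).X₂)) g' f' h' hm'
    (fun n => iter_mem hS n (h2 n)) ?_
  intro i n
  by_cases hi : i = -n
  · exact IsZero.eq_of_tgt (conc_iter (n+1) (conc_single _) _ (by push_cast; lia)) _ _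
  · exact IsZero.eq_of_src (conc_iter n (conc_single _) _ (by lia)) _ _
end P3

section P4
variable {R : Type} [CommRing R] 
open DerivedCategory

def TorV (V : Set (Ideal R)) (M : Type) [AddCommGroup M] [Module R M] : Prop :=
  ∀ p : Ideal R, p.IsPrime → p ∉ V → ∀ x : M, ∃ r : R, r ∉ p ∧ r • x = 0

lemma TorV.of_inj {V : Set (Ideal R)} {M N : Type} [AddCommGroup M] [Module R M]
    [AddCommGroup N] [Module R N] (f : M →ₗ[R] N) (hf : Function.Injective f) (h : TorV V N) :
    TorV V M := by
  intro p hp hV x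
  obtain ⟨r, hr, hx⟩ := h p hp hV (f x)
  exact ⟨r, hr, hf (by rw [map_smul, hx, map_zero])⟩

lemma TorV.of_surj {V : Set (Ideal R)} {M N : Type} [AddCommGroup M] [Module R M]
    [AddCommGroup N] [Module R N] (f : M →ₗ[R] N) (hf : Function.Surjective f) (h : TorV V M) :
    TorV V N := by
  intro p hp hV y
  obtain ⟨x, rfl⟩ := hf y
  obtain ⟨r, hr, hx⟩ := h p hp hV x
  exact ⟨r, hr, by rw [← map_smul, hx, map_zero]⟩

lemma TorV.directSum {V : Set (Ideal R)} {ι : Type} (M : ι → Type)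
    [∀ i, AddCommGroup (M i)] [∀ i, Module R (M i)] (h : ∀ i, TorV V (M i)) :
    TorV V (DirectSum ι M) := by
  classical
  intro p hp hV x
  induction x using DirectSum.induction_on with
  | zero => exact ⟨1, (Ideal.ne_top_iff_one p).1 hp.ne_top, by simp⟩
  | of i x =>
    obtain ⟨r, hr, hx⟩ := h i p hp hV x
    refine ⟨r, hr, ?_⟩
    change r • DirectSum.lof R ι M i x = 0
    rw [← map_smul, hx, map_zero]
  | add x y hx hy =>
    obtain ⟨r, hr, hx⟩ := hx
    obtain ⟨s, hs, hy⟩ := hy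
    refine ⟨r * s, fun hh => (hp.mem_or_mem hh).elim hr hs, ?_⟩
    rw [smul_add, mul_comm, mul_smul, hx, mul_comm, mul_smul, hy]; simp

lemma TorV.ass [IsNoetherianRing R] (B : Type) [AddCommGroup B] [Module R B] :
    TorV {p : Ideal R | ∃ q ∈ associatedPrimes R B, q ≤ p} B := by
  intro p hp hV x
  by_contra! hc
  apply hV
  have hle : Module.annihilator R (Submodule.span R {x}) ≤ p := by
    intro r hr
    by_contra hrp
    refine hc r hrp ?_
    rw [Module.mem_annihilator] at hr
    exact congrArg Subtype.val (hr ⟨x, Submodule.mem_span_singleton_self x⟩)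
  obtain ⟨q, hq, hqp⟩ := Ideal.exists_minimalPrimes_le hle
  have := Module.associatedPrimes.minimalPrimes_annihilator_subset_associatedPrimes R (Submodule.span R {x}) hq
  exact ⟨q, associatedPrimes.subset_of_injective (Submodule.injective_subtype _) this, hqp⟩

lemma mkShort {A B C : Type} [AddCommGroup A] [Module R A] [AddCommGroup B] [Module R B]
    [AddCommGroup C] [Module R C] (f : A →ₗ[R] B) (g : B →ₗ[R] C) (hf : Function.Injective f)
    (hg : Function.Surjective g) (h : Function.Exact f g) :
    ∃ w, (ShortComplex.mk (ModuleCat.ofHom f) (ModuleCat.ofHom g) w).ShortExact :=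
  ⟨_, ModuleCat.shortComplex_shortExact (ShortComplex.mk (ModuleCat.ofHom f) (ModuleCat.ofHom g)
    (by ext x; exact h.apply_apply_eq_zero x)) h hf hg⟩

variable [HasDerivedCategory.{w} (ModuleCat.{0} R)]

lemma fg_mem [IsNoetherianRing R] {S : Set (DerivedCategory (ModuleCat R))}
    (hS : IsCocompletePreaisle R S)
    (V : Set (Ideal R)) (hgen : ∀ p : Ideal R, p.IsPrime → p ∈ V →
      (singleFunctor _ 0).obj (ModuleCat.of R (R ⧸ p)) ∈ S)
    (M : Type) [AddCommGroup M] [Module R M] [hM : Module.Finite R M] :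
    TorV V M → (singleFunctor _ 0).obj (ModuleCat.of R M) ∈ S := by
  induction hM using IsNoetherianRing.induction_on_isQuotientEquivQuotientPrime R with
  | subsingleton N =>
    intro _
    exact zero_memS hS (Functor.map_isZero _ (ModuleCat.isZero_of_subsingleton _))
  | quotient N p e =>
    intro h
    have hp : p.1 ∈ V := by
      by_contra hV
      obtain ⟨r, hr, hx⟩ := h p.1 p.2 hV (e.symm (Ideal.Quotient.mk _ 1))
      rw [← map_smul, LinearEquiv.map_eq_zero_iff] at hx
      apply hr
      rw [← Ideal.Quotient.eq_zero_iff_mem, ← hx]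
      simp [Algebra.smul_def]
    exact hS.mem_of_iso ((singleFunctor _ 0).mapIso e.symm.toModuleIso) (hgen _ p.2 hp)
  | exact N₁ N₂ N₃ f g hf hg hfg h1 h3 =>
    intro h
    obtain ⟨w, hw⟩ := mkShort f g hf hg hfg
    exact hS.ext_mem _ _ _ hw.singleTriangle_distinguished (h1 (h.of_inj f hf))
      (h3 (h.of_surj g hg))

lemma step_mem [IsNoetherianRing R] {S : Set (DerivedCategory (ModuleCat R))}
    (hS : IsCocompletePreaisle R S)
    (V : Set (Ideal R)) (hgen : ∀ p : Ideal R, p.IsPrime → p ∈ V →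
      (singleFunctor _ 0).obj (ModuleCat.of R (R ⧸ p)) ∈ S)
    (K : ModuleCat.{0} R) (hK : TorV V K) :
    ∃ A : ShortComplex (ModuleCat.{0} R), A.ShortExact ∧ A.X₃ = K ∧ TorV V A.X₁ ∧
      (singleFunctor _ 0).obj A.X₂ ∈ S := by
  classical
  have hZ : ∀ x, TorV V (Submodule.span R {x}) := fun x =>
    hK.of_inj (Submodule.subtype _) (Submodule.injective_subtype _)
  let g : DirectSum K (fun x => Submodule.span R {x}) →ₗ[R] K :=
    DirectSum.toModule R K K (fun x => (Submodule.span R {x}).subtype)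
  have hg : Function.Surjective g := fun x =>
    ⟨DirectSum.lof R K (fun x => Submodule.span R {x}) x ⟨x, Submodule.mem_span_singleton_self x⟩,
      by simp only [g, DirectSum.toModule_lof]; rfl⟩
  obtain ⟨w, hw⟩ := mkShort (A := LinearMap.ker g) (LinearMap.ker g).subtype g (Submodule.injective_subtype _) hg
    (LinearMap.exact_subtype_ker_map g)
  refine ⟨_, hw, rfl, ?_, ?_⟩
  · exact (TorV.directSum _ hZ).of_inj (LinearMap.ker g).subtype (Submodule.injective_subtype _)
  · have hc := isColimitCofanMkObjOfIsColimit (singleFunctor (ModuleCat.{0} R) 0) _ _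
      (ModuleCat.coproductCoconeIsColimit (fun x : K => ModuleCat.of R (Submodule.span R {x})))
    exact hS.coproduct_mem _ _ hc (fun x => fg_mem hS V hgen _ (hZ x))

lemma main_mem [IsNoetherianRing R] {S : Set (DerivedCategory (ModuleCat R))}
    (hS : IsCocompletePreaisle R S)
    (V : Set (Ideal R)) (hgen : ∀ p : Ideal R, p.IsPrime → p ∈ V →
      (singleFunctor _ 0).obj (ModuleCat.of R (R ⧸ p)) ∈ S)
    (K : ModuleCat.{0} R) (hK : TorV V K) : (singleFunctor _ 0).obj K ∈ S := by
  choose A hA h3 h1 h2 using step_mem hS V hgen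
  let s : ℕ → {K : ModuleCat.{0} R // TorV V K} := fun n =>
    Nat.rec ⟨K, hK⟩ (fun _ k => ⟨(A k.1 k.2).X₁, h1 k.1 k.2⟩) n
  have := tower_mod hS (fun n => A (s n).1 (s n).2) (fun n => hA _ _)
    (fun n => (h3 (s (n+1)).1 (s (n+1)).2).symm) (fun n => h2 _ _)
  rw [h3] at this
  exact this
end P4

theorem stmt6 (R : Type) [CommRing R] [IsNoetherianRing R]
    [HasDerivedCategory.{w} (ModuleCat R)]
    (B : Type) [AddCommGroup B] [Module R B]
    (S : Set (DerivedCategory (ModuleCat R))) (hS : IsCocompletePreaisle R S)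
    (hgen : ∀ p : Ideal R, p.IsPrime → (∃ q ∈ associatedPrimes R B, q ≤ p) →
      sdeg R 0 (ModuleCat.of R (R ⧸ p)) ∈ S) :
    sdeg R 0 (ModuleCat.of R B) ∈ S := by
  simp only [sdeg, neg_zero] at hgen ⊢
  exact main_mem hS _ hgen (ModuleCat.of R B) (TorV.ass B)
end

section
/- Let R be a commutative Noetherian ring and M ∈ D(R) with H_i(M) = 0 for all but finitely many i ∈ ℤ. Let S be any cocomplete preaisle in D(R) that contains s^i(R/p) for every i ∈ ℤ and every prime p in the specialization closure of Ass H_i(M). Then M ∈ S. -/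
open CategoryTheory CategoryTheory.Limits CategoryTheory.Pretriangulated

universe w

section A
variable {R : Type} [CommRing R]

lemma mod_span {ι : Type} {X : ι → ModuleCat.{0} R} (c : Cofan X) (hc : IsColimit c) :
    (⨆ i, LinearMap.range (c.inj i).hom) = ⊤ := by
  set U := (⨆ i, LinearMap.range (c.inj i).hom) with hU
  have h : ModuleCat.ofHom U.mkQ = (0 : c.pt ⟶ ModuleCat.of R (c.pt ⧸ U)) := by
    refine Cofan.IsColimit.hom_ext hc _ _ (fun i => ?_)
    ext x
    simp only [ModuleCat.hom_comp, ModuleCat.hom_ofHom, LinearMap.comp_apply, comp_zero, ModuleCat.hom_zero, LinearMap.zero_apply]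
    rw [Submodule.mkQ_apply, Submodule.Quotient.mk_eq_zero]
    exact (le_iSup (fun i => LinearMap.range (c.inj i).hom) i) ⟨x, rfl⟩
  have h2 : U.mkQ = 0 := by
    have := congrArg ModuleCat.Hom.hom h
    simpa using this
  rw [← Submodule.ker_mkQ U, h2, LinearMap.ker_zero]

abbrev Cx (R : Type) [CommRing R] := CochainComplex (ModuleCat.{0} R) ℤ

open Classical in
noncomputable def cpr {ι : Type} {X : ι → Cx R} {c : Cofan X} (hc : IsColimit c) (i : ι) :
    c.pt ⟶ X i :=
  Cofan.IsColimit.desc hc (fun j => if h : j = i then eqToHom (by rw [h]) else 0)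

lemma inj_cpr_self {ι : Type} {X : ι → Cx R} {c : Cofan X} (hc : IsColimit c) (i : ι) :
    c.inj i ≫ cpr hc i = 𝟙 _ := by
  simp [cpr]

lemma inj_cpr_ne {ι : Type} {X : ι → Cx R} {c : Cofan X} (hc : IsColimit c) (i j : ι) (h : j ≠ i) :
    c.inj j ≫ cpr hc i = 0 := by
  simp [cpr, h]

def Good {ι : Type} {X : ι → Cx R} {c : Cofan X} (hc : IsColimit c)
    (G : Cx R ⥤ ModuleCat.{0} R) : Prop :=
  ∀ x : G.obj c.pt, ∃ F : Finset ι,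
    x = ∑ i ∈ F, (G.map (cpr hc i ≫ c.inj i)).hom x

lemma good_eval {ι : Type} {X : ι → Cx R} {c : Cofan X} (hc : IsColimit c) (n : ℤ) :
    Good hc (HomologicalComplex.eval _ _ n) := by
  classical
  let G := HomologicalComplex.eval (ModuleCat.{0} R) (ComplexShape.up ℤ) n
  intro x
  have hc' : IsColimit (Cofan.mk (G.obj c.pt) (fun i => G.map (c.inj i)) : Cofan (fun i => G.obj (X i))) :=
    isColimitCofanMkObjOfIsColimit G X c.inj (hc.ofIsoColimit (Cocone.ext (Iso.refl _) (by
      rintro ⟨j⟩; simp; rfl)))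
  have := mod_span _ hc'
  have hx : x ∈ (⨆ i, LinearMap.range (G.map (c.inj i)).hom) := by
    have e : (⨆ i, LinearMap.range (G.map (c.inj i)).hom) = ⊤ := this
    rw [e]; trivial
  suffices H : ∃ F : Finset ι, ∀ F', F ⊆ F' → x = ∑ i ∈ F', (G.map (cpr hc i ≫ c.inj i)).hom x by
    obtain ⟨F, hF⟩ := H
    exact ⟨F, hF F (subset_refl _)⟩
  refine Submodule.iSup_induction _ (motive := fun x => ∃ F : Finset ι, ∀ F', F ⊆ F' → x = ∑ i ∈ F', (G.map (cpr hc i ≫ c.inj i)).hom x) hx ?_ ?_ ?_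
  · rintro i _ ⟨y, rfl⟩
    refine ⟨{i}, fun F' hF' => ?_⟩
    have hi : i ∈ F' := hF' (Finset.mem_singleton_self i)
    have key : ∀ j, (G.map (cpr hc j ≫ c.inj j)).hom ((G.map (c.inj i)).hom y)
        = (G.map (c.inj i ≫ cpr hc j ≫ c.inj j)).hom y := by
      intro j
      rw [G.map_comp (c.inj i)]; rfl
    rw [Finset.sum_eq_single i]
    · rw [key, reassoc_of% (inj_cpr_self hc i)]
    · intro j _ hj
      rw [key, reassoc_of% (inj_cpr_ne hc j i hj.symm)]
      simp
    · intro h; exact absurd hi h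
  · exact ⟨∅, fun F' _ => by simp⟩
  · rintro x y ⟨F1, h1⟩ ⟨F2, h2⟩
    refine ⟨F1 ∪ F2, fun F' h => ?_⟩
    conv_lhs => rw [h1 F' (Finset.union_subset_left h), h2 F' (Finset.union_subset_right h)]
    simp only [map_add, Finset.sum_add_distrib]

lemma good_sub {ι : Type} {X : ι → Cx R} {c : Cofan X} (hc : IsColimit c)
    (G G' : Cx R ⥤ ModuleCat.{0} R) (τ : G' ⟶ G) [Mono (τ.app c.pt)] (h : Good hc G) :
    Good hc G' := by
  intro x
  obtain ⟨F, hF⟩ := h ((τ.app c.pt).hom x)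
  refine ⟨F, ?_⟩
  have inj : Function.Injective (τ.app c.pt).hom :=
    (ModuleCat.mono_iff_injective _).1 inferInstance
  apply inj
  rw [map_sum]
  refine hF.trans (Finset.sum_congr rfl fun i _ => ?_)
  exact (congrArg (fun f => f.hom x) (τ.naturality (cpr hc i ≫ c.inj i))).symm

lemma good_quot {ι : Type} {X : ι → Cx R} {c : Cofan X} (hc : IsColimit c)
    (G G' : Cx R ⥤ ModuleCat.{0} R) (τ : G ⟶ G') [Epi (τ.app c.pt)] (h : Good hc G) :
    Good hc G' := by
  intro x
  have sur : Function.Surjective (τ.app c.pt).hom :=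
    (ModuleCat.epi_iff_surjective _).1 inferInstance
  obtain ⟨z, rfl⟩ := sur x
  obtain ⟨F, hF⟩ := h z
  refine ⟨F, ?_⟩
  conv_lhs => rw [hF]
  rw [map_sum]
  refine (Finset.sum_congr rfl fun i _ => ?_)
  exact (congrArg (fun f => f.hom z) (τ.naturality (cpr hc i ≫ c.inj i)))

lemma good_homology {ι : Type} {X : ι → Cx R} {c : Cofan X} (hc : IsColimit c) (n : ℤ) :
    Good hc (HomologicalComplex.homologyFunctor _ _ n) := by
  let τ : HomologicalComplex.cyclesFunctor (ModuleCat.{0} R) (ComplexShape.up ℤ) n ⟶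
      HomologicalComplex.eval _ _ n :=
    { app := fun K => K.iCycles n
      naturality := fun _ _ f => HomologicalComplex.cyclesMap_i f n }
  let τ' : HomologicalComplex.cyclesFunctor (ModuleCat.{0} R) (ComplexShape.up ℤ) n ⟶
      HomologicalComplex.homologyFunctor _ _ n :=
    { app := fun K => K.homologyπ n
      naturality := fun _ _ f => (HomologicalComplex.homologyπ_naturality f n).symm }
  have : Mono (τ.app c.pt) := inferInstanceAs (Mono (c.pt.iCycles n))
  have : Epi (τ'.app c.pt) := inferInstanceAs (Epi (c.pt.homologyπ n))
  exact good_quot hc _ _ τ' (good_sub hc _ _ τ (good_eval hc n))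

lemma quasiIso_coprod {ι : Type} {X X' : ι → Cx R} {c : Cofan X} (hc : IsColimit c)
    {c' : Cofan X'} (hc' : IsColimit c') (f : ∀ i, X' i ⟶ X i) [∀ i, QuasiIso (f i)]
    (g : c'.pt ⟶ c.pt) (hg : ∀ i, c'.inj i ≫ g = f i ≫ c.inj i) : QuasiIso g := by
  rw [quasiIso_iff]
  intro n
  rw [quasiIsoAt_iff_isIso_homologyMap]
  let G := HomologicalComplex.homologyFunctor (ModuleCat.{0} R) (ComplexShape.up ℤ) n
  have comm : ∀ i, g ≫ cpr hc i = cpr hc' i ≫ f i := by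
    intro i
    refine Cofan.IsColimit.hom_ext hc' _ _ (fun j => ?_)
    rw [← Category.assoc, hg, Category.assoc]
    by_cases h : j = i
    · subst h
      rw [inj_cpr_self, reassoc_of% (inj_cpr_self hc' j)]; simp
    · rw [inj_cpr_ne _ _ _ h, reassoc_of% (inj_cpr_ne hc' i j h)]; simp
  have isof : ∀ i, IsIso (G.map (f i)) := fun i =>
    (quasiIsoAt_iff_isIso_homologyMap (f i) n).1 inferInstance
  change IsIso (G.map g)
  rw [ConcreteCategory.isIso_iff_bijective]
  constructor
  · change Function.Injective (G.map g).hom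
    rw [injective_iff_map_eq_zero]
    intro x hx
    obtain ⟨F, hF⟩ := good_homology hc' n x
    rw [hF]
    refine Finset.sum_eq_zero fun i _ => ?_
    have h1 : (G.map (f i)).hom ((G.map (cpr hc' i)).hom x) = 0 := by
      have : G.map (cpr hc' i) ≫ G.map (f i) = G.map g ≫ G.map (cpr hc i) := by
        rw [← G.map_comp, ← G.map_comp, comm]
      have := congrArg (fun f => f.hom x) this
      refine this.trans ?_
      simp [hx]
    have h2 : (G.map (cpr hc' i)).hom x = 0 := by
      have hinj : Function.Injective (G.map (f i)).hom := ((ConcreteCategory.isIso_iff_bijective _).1 (isof i)).1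
      apply hinj
      rw [h1, map_zero]
    change (G.map (cpr hc' i ≫ c'.inj i)).hom x = 0
    rw [G.map_comp]
    simp [h2]
  · change Function.Surjective (G.map g).hom
    rw [← LinearMap.range_eq_top, eq_top_iff]
    intro x _
    obtain ⟨F, hF⟩ := good_homology hc n x
    rw [hF]
    refine Submodule.sum_mem _ fun i _ => ?_
    have hs : Function.Surjective (G.map (f i)).hom := ((ConcreteCategory.isIso_iff_bijective _).1 (isof i)).2
    obtain ⟨y, hy⟩ := hs ((G.map (cpr hc i)).hom x)
    refine ⟨(G.map (c'.inj i)).hom y, ?_⟩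
    have h3 : G.map (c'.inj i) ≫ G.map g = G.map (f i) ≫ G.map (c.inj i) := by
        rw [← G.map_comp, ← G.map_comp, hg]
    refine (congrArg (fun f => f.hom y) h3).trans ?_
    change _ = (G.map (cpr hc i ≫ c.inj i)).hom x
    rw [G.map_comp]
    simp [hy]

end A

section B
variable {R : Type} [CommRing R] [HasDerivedCategory.{w} (ModuleCat.{0} R)]
open DerivedCategory

lemma Q_map_zero_fac {X Y : Cx R} (g : X ⟶ Y) (h : Q.map g = 0) :
    ∃ (X' : Cx R) (s : X' ⟶ X) (_ : QuasiIso s), Nonempty (Homotopy (s ≫ g) 0) := by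
  have h' : Qh.map ((HomotopyCategory.quotient _ _).map g) = Qh.map 0 := by
    have := quotientCompQhIso_hom_naturality g
    rw [h, comp_zero] at this
    rw [Functor.map_zero]
    rw [← cancel_mono ((quotientCompQhIso _).hom.app Y), this, zero_comp]
  rw [MorphismProperty.map_eq_iff_precomp Qh (HomotopyCategory.quasiIso _ _)] at h'
  obtain ⟨X', s, hs, hh⟩ := h'
  obtain ⟨X', rfl⟩ := HomotopyCategory.quotient_obj_surjective X'
  obtain ⟨s, rfl⟩ := (HomotopyCategory.quotient _ _).map_surjective s
  rw [comp_zero, ← Functor.map_comp] at hh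
  rw [← isIso_Qh_map_iff] at hs
  have hs' : IsIso (Q.map s) := hs
  refine ⟨X', s, (isIso_Q_map_iff_quasiIso _ s).1 hs', ⟨HomotopyCategory.homotopyOfEq _ _ ?_⟩⟩
  rw [hh, Functor.map_zero]

/-- homotopies on a coproduct -/
lemma homotopy_coprod {ι : Type} {X : ι → Cx R} {c : Cofan X} (hc : IsColimit c)
    {Y : Cx R} (g : c.pt ⟶ Y) (h : ∀ i, Nonempty (Homotopy (c.inj i ≫ g) 0)) :
    Nonempty (Homotopy g 0) := by
  have h := fun i => (h i).some
  let G := fun n => HomologicalComplex.eval (ModuleCat.{0} R) (ComplexShape.up ℤ) n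
  have hcn : ∀ n, IsColimit (Cofan.mk ((G n).obj c.pt) (fun i => (G n).map (c.inj i)) : Cofan (fun i => (G n).obj (X i))) := fun n =>
    isColimitCofanMkObjOfIsColimit (G n) X c.inj (hc.ofIsoColimit (Cocone.ext (Iso.refl _) (by
      rintro ⟨j⟩; simp; rfl)))
  let hm : ∀ a b : ℤ, c.pt.X a ⟶ Y.X b := fun a b =>
    Cofan.IsColimit.desc (hcn a) (fun i => (h i).hom a b)
  have hfac : ∀ a b i, (c.inj i).f a ≫ hm a b = (h i).hom a b := fun a b i =>
    Cofan.IsColimit.fac (hcn a) (fun i => (h i).hom a b) i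
  refine ⟨{ hom := hm, zero := ?_, comm := ?_ }⟩
  · intro a b hab
    refine Cofan.IsColimit.hom_ext (hcn a) _ _ (fun i => ?_)
    refine (hfac a b i).trans ?_
    rw [(h i).zero a b hab]
    exact comp_zero.symm
  · intro n
    refine Cofan.IsColimit.hom_ext (hcn n) _ _ (fun i => ?_)
    change (c.inj i).f n ≫ _ = (c.inj i).f n ≫ _
    have := (h i).comm n
    simp only [HomologicalComplex.comp_f, HomologicalComplex.zero_f, add_zero] at this ⊢
    rw [this, Preadditive.comp_add]
    congr 1
    · rw [dNext_eq _ (show (ComplexShape.up ℤ).Rel n (n+1) from rfl),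
        dNext_eq _ (show (ComplexShape.up ℤ).Rel n (n+1) from rfl), ← hfac]
      simp
    · rw [prevD_eq _ (show (ComplexShape.up ℤ).Rel (n-1) n by simp),
        prevD_eq _ (show (ComplexShape.up ℤ).Rel (n-1) n by simp), ← hfac]
      simp

lemma Q_hom_ext_zero {ι : Type} {X : ι → Cx R} {c : Cofan X} (hc : IsColimit c)
    {Y : Cx R} (f : Q.obj c.pt ⟶ Q.obj Y) (h : ∀ i, Q.map (c.inj i) ≫ f = 0) : f = 0 := by
  obtain ⟨Y', g, s, hs, rfl⟩ := left_fac f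
  have h1 : ∀ i, Q.map (c.inj i ≫ g) = 0 := by
    intro i
    have := h i
    rw [← Category.assoc, ← Q.map_comp] at this
    rw [← cancel_mono (inv (Q.map s)), this, zero_comp]
  choose X' t ht hh using fun i => Q_map_zero_fac _ (h1 i)
  let c' : Cofan X' := (colimit.cocone (Discrete.functor X'))
  let hc' : IsColimit c' := colimit.isColimit _
  let u : c'.pt ⟶ c.pt := Cofan.IsColimit.desc hc' (fun i => t i ≫ c.inj i)
  have hu : ∀ i, c'.inj i ≫ u = t i ≫ c.inj i := fun i => Cofan.IsColimit.fac hc' _ i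
  have : QuasiIso u := quasiIso_coprod hc hc' t u hu
  have h2 : Nonempty (Homotopy (u ≫ g) 0) := homotopy_coprod hc' _ (fun i => by
    rw [← Category.assoc, hu, Category.assoc]; exact hh i)
  have h3 := Q_map_eq_of_homotopy _ h2.some
  rw [Q.map_comp, Q.map_zero] at h3
  have h4 : Q.map g = 0 := by
    rw [← cancel_epi (Q.map u), h3, comp_zero]
  rw [h4, zero_comp]

lemma Q_exists_desc {ι : Type} {X : ι → Cx R} {c : Cofan X} (hc : IsColimit c)
    {Y : Cx R} (f : ∀ i, Q.obj (X i) ⟶ Q.obj Y) :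
    ∃ g : Q.obj c.pt ⟶ Q.obj Y, ∀ i, Q.map (c.inj i) ≫ g = f i := by
  choose X' t ht a ha using fun i => right_fac (f i)
  have ht' : ∀ i, QuasiIso (t i) := fun i => (isIso_Q_map_iff_quasiIso _ _).1 (ht i)
  let c' : Cofan X' := (colimit.cocone (Discrete.functor X'))
  let hc' : IsColimit c' := colimit.isColimit _
  let u : c'.pt ⟶ c.pt := Cofan.IsColimit.desc hc' (fun i => t i ≫ c.inj i)
  have hu : ∀ i, c'.inj i ≫ u = t i ≫ c.inj i := fun i => Cofan.IsColimit.fac hc' _ i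
  have : QuasiIso u := quasiIso_coprod hc hc' t u hu
  let v : c'.pt ⟶ Y := Cofan.IsColimit.desc hc' a
  have hv : ∀ i, c'.inj i ≫ v = a i := fun i => Cofan.IsColimit.fac hc' _ i
  refine ⟨inv (Q.map u) ≫ Q.map v, fun i => ?_⟩
  rw [ha, ← cancel_epi (Q.map (t i)), IsIso.hom_inv_id_assoc, ← hv, Q.map_comp,
    ← Q.map_comp_assoc, ← hu, Q.map_comp, Category.assoc, IsIso.hom_inv_id_assoc]

lemma Q_coprod {ι : Type} {X : ι → Cx R} {c : Cofan X} (hc : IsColimit c) :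
    Nonempty (IsColimit (Cofan.mk (Q.obj c.pt) (fun i => Q.map (c.inj i)) :
      Cofan (fun i => Q.obj (X i)))) := by
  have ex : ∀ (Z : DerivedCategory (ModuleCat.{0} R)) (f : ∀ i, Q.obj (X i) ⟶ Z),
      ∃ g : Q.obj c.pt ⟶ Z, ∀ i, Q.map (c.inj i) ≫ g = f i := by
    intro Z f
    obtain ⟨g, hg⟩ := Q_exists_desc hc (fun i => f i ≫ (Q.objObjPreimageIso Z).inv)
    exact ⟨g ≫ (Q.objObjPreimageIso Z).hom, fun i => by simp [reassoc_of% (hg i)]⟩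
  have un : ∀ (Z : DerivedCategory (ModuleCat.{0} R)) (f : Q.obj c.pt ⟶ Z),
      (∀ i, Q.map (c.inj i) ≫ f = 0) → f = 0 := by
    intro Z f hf
    have := Q_hom_ext_zero hc (f ≫ (Q.objObjPreimageIso Z).inv) (fun i => by
      rw [reassoc_of% (hf i), zero_comp])
    rw [← cancel_mono (Q.objObjPreimageIso Z).inv, this, zero_comp]
  refine ⟨Cofan.IsColimit.mk _ (fun s => (ex _ s.inj).choose) (fun s i => (ex _ s.inj).choose_spec i)
    (fun s m hm => ?_)⟩
  rw [← sub_eq_zero]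
  refine un _ _ (fun i => ?_)
  rw [Preadditive.comp_sub, sub_eq_zero, (ex _ s.inj).choose_spec i]
  exact hm i

/-- existence of coproducts with jointly epi homology -/
lemma D_coprod {ι : Type} (X : ι → DerivedCategory (ModuleCat.{0} R)) :
    ∃ (c : Cofan X) (_ : IsColimit c), ∀ (n : ℤ) (Z : ModuleCat.{0} R)
      (f : (homologyFunctor _ n).obj c.pt ⟶ Z),
      (∀ i, (homologyFunctor _ n).map (c.inj i) ≫ f = 0) → f = 0 := by
  let X' := fun i => Q.objPreimage (X i)
  let e := fun i => Q.objObjPreimageIso (X i)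
  let c' : Cofan X' := (colimit.cocone (Discrete.functor X'))
  let hc' : IsColimit c' := colimit.isColimit _
  obtain ⟨h⟩ := Q_coprod hc'
  let d : Cofan X := Cofan.mk (Q.obj c'.pt) (fun i => (e i).inv ≫ Q.map (c'.inj i))
  refine ⟨d, ?_, ?_⟩
  · refine Cofan.IsColimit.mk _ (fun s => Cofan.IsColimit.desc h (fun i => (e i).hom ≫ s.inj i)) ?_ ?_
    · intro s i
      have := Cofan.IsColimit.fac h (fun i => (e i).hom ≫ s.inj i) i
      change ((e i).inv ≫ Q.map (c'.inj i)) ≫ _ = _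
      change Q.map (c'.inj i) ≫ _ = _ at this
      rw [Category.assoc, this, Iso.inv_hom_id_assoc]
    · intro s m hm
      refine Cofan.IsColimit.hom_ext h _ _ (fun i => ?_)
      have := Cofan.IsColimit.fac h (fun i => (e i).hom ≫ s.inj i) i
      refine Eq.trans ?_ this.symm
      rw [← hm i]
      change _ = (e i).hom ≫ ((e i).inv ≫ Q.map (c'.inj i)) ≫ m
      simp
  · intro n Z f hf
    let H := homologyFunctor (ModuleCat.{0} R) n
    let φ := homologyFunctorFactors (ModuleCat.{0} R) n
    rw [← cancel_epi (φ.inv.app c'.pt), comp_zero]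
    ext x
    obtain ⟨F, hF⟩ := good_homology hc' n x
    rw [hF, map_sum]
    refine (Finset.sum_eq_zero fun i _ => ?_)
    have key : (HomologicalComplex.homologyFunctor _ _ n).map (cpr hc' i ≫ c'.inj i) ≫ φ.inv.app c'.pt ≫ f = 0 := by
      have h1 := hf i
      change H.map ((e i).inv ≫ Q.map (c'.inj i)) ≫ f = 0 at h1
      rw [H.map_comp, Category.assoc] at h1
      replace h1 : H.map (Q.map (c'.inj i)) ≫ f = 0 := by
        rw [← cancel_epi (H.map (e i).inv), h1, comp_zero]
      have h2 := φ.inv.naturality (c'.inj i)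
      rw [Functor.map_comp, Category.assoc, reassoc_of% h2]
      change _ ≫ _ ≫ H.map (Q.map (c'.inj i)) ≫ f = 0
      rw [h1, comp_zero, comp_zero]
    have := congrArg (fun f => f.hom x) key
    exact this

end B

section Ctri
variable {C : Type*} [Category C] [Preadditive C] [HasZeroObject C] [HasShift C ℤ]
  [∀ n : ℤ, (shiftFunctor C n).Additive] [Pretriangulated C]

lemma coprod_triangle {ι : Type} (T : ι → Triangle C) (hT : ∀ i, T i ∈ distTriang C)
    {c1 : Cofan (fun i => (T i).obj₁)} (h1 : IsColimit c1)
    {c2 : Cofan (fun i => (T i).obj₂)} (h2 : IsColimit c2)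
    {c3 : Cofan (fun i => (T i).obj₃)} (h3 : IsColimit c3)
    (f : c1.pt ⟶ c2.pt) (hf : ∀ i, c1.inj i ≫ f = (T i).mor₁ ≫ c2.inj i)
    (g : c2.pt ⟶ c3.pt) (hg : ∀ i, c2.inj i ≫ g = (T i).mor₂ ≫ c3.inj i) :
    ∃ h, Triangle.mk f g h ∈ distTriang C := by
  obtain ⟨Z, f2, f3, hZ⟩ := distinguished_cocone_triangle f
  have hg' : ∀ i, ∃ γ : (T i).obj₃ ⟶ Z, (T i).mor₂ ≫ γ = c2.inj i ≫ f2 ∧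
      (T i).mor₃ ≫ (c1.inj i)⟦(1:ℤ)⟧' = γ ≫ f3 := fun i => by
    obtain ⟨γ, a, b⟩ := complete_distinguished_triangle_morphism _ _ (hT i) hZ (c1.inj i) (c2.inj i)
      (hf i).symm
    exact ⟨γ, a, b⟩
  choose γ hγ2 hγ3 using hg'
  let F := shiftFunctor C (1:ℤ)
  have hs : ∀ {X : ι → C} {c : Cofan X} (hc : IsColimit c),
      IsColimit (Cofan.mk (F.obj c.pt) (fun i => F.map (c.inj i)) : Cofan (fun i => F.obj (X i))) :=
    fun {X c} hc => isColimitCofanMkObjOfIsColimit F X c.inj (hc.ofIsoColimit (Cocone.ext (Iso.refl _) (by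
      rintro ⟨j⟩; simp; rfl)))
  have s1 := hs h1
  have s2 := hs h2
  let Γ : c3.pt ⟶ Z := Cofan.IsColimit.desc h3 γ
  have hΓ : ∀ i, c3.inj i ≫ Γ = γ i := fun i => Cofan.IsColimit.fac h3 γ i
  have z12 : f ≫ f2 = 0 := comp_distTriang_mor_zero₁₂ _ hZ
  have z23 : f2 ≫ f3 = 0 := comp_distTriang_mor_zero₂₃ _ hZ
  have z31 : f3 ≫ f⟦(1:ℤ)⟧' = 0 := comp_distTriang_mor_zero₃₁ _ hZ
  have inj : ∀ (A : C) (z : Z ⟶ A), Γ ≫ z = 0 → z = 0 := by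
    intro A z hz
    have hzi : ∀ i, γ i ≫ z = 0 := fun i => by rw [← hΓ, Category.assoc, hz, comp_zero]
    have e1 : f2 ≫ z = 0 := by
      refine Cofan.IsColimit.hom_ext h2 _ _ (fun i => ?_)
      rw [← Category.assoc, ← hγ2, Category.assoc, hzi, comp_zero, comp_zero]
    obtain ⟨y, rfl⟩ := Triangle.yoneda_exact₃ _ hZ z e1
    change c1.pt⟦(1:ℤ)⟧ ⟶ A at y
    change ∀ i, γ i ≫ f3 ≫ y = 0 at hzi
    have e2 : ∀ i, ∃ w : (T i).obj₂⟦(1:ℤ)⟧ ⟶ A, (c1.inj i)⟦(1:ℤ)⟧' ≫ y = (T i).mor₁⟦(1:ℤ)⟧' ≫ w := by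
      intro i
      have k1 : (T i).mor₃ ≫ (c1.inj i)⟦(1:ℤ)⟧' ≫ y = 0 := by
        rw [← Category.assoc, hγ3, Category.assoc, hzi]
      obtain ⟨w, hw⟩ := Triangle.yoneda_exact₃ _ (rot_of_distTriang _ (hT i))
        ((c1.inj i)⟦(1:ℤ)⟧' ≫ y) k1
      change (T i).obj₂⟦(1:ℤ)⟧ ⟶ A at w
      change (c1.inj i)⟦(1:ℤ)⟧' ≫ y = (-((T i).mor₁⟦(1:ℤ)⟧')) ≫ w at hw
      refine ⟨-w, ?_⟩
      rw [hw, Preadditive.neg_comp, Preadditive.comp_neg]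
    choose w hw using e2
    let W : c2.pt⟦(1:ℤ)⟧ ⟶ A := Cofan.IsColimit.desc s2 w
    have hW : ∀ i, (c2.inj i)⟦(1:ℤ)⟧' ≫ W = w i := fun i => Cofan.IsColimit.fac s2 w i
    have e3 : y = f⟦(1:ℤ)⟧' ≫ W := by
      refine Cofan.IsColimit.hom_ext s1 _ _ (fun i => ?_)
      change (c1.inj i)⟦(1:ℤ)⟧' ≫ _ = (c1.inj i)⟦(1:ℤ)⟧' ≫ _
      rw [hw, ← Category.assoc, ← Functor.map_comp, hf, Functor.map_comp, Category.assoc, hW]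
    change f3 ≫ y = 0
    rw [e3, ← Category.assoc, z31, zero_comp]
  have surj : ∀ (A : C) (a : c3.pt ⟶ A), ∃ z : Z ⟶ A, Γ ≫ z = a := by
    intro A a
    have e1 : f ≫ g ≫ a = 0 := by
      refine Cofan.IsColimit.hom_ext h1 _ _ (fun i => ?_)
      have := comp_distTriang_mor_zero₁₂ _ (hT i)
      rw [← Category.assoc, hf, Category.assoc, ← Category.assoc _ g, hg, Category.assoc,
        ← Category.assoc, this, zero_comp, comp_zero]
    obtain ⟨z, hz⟩ := Triangle.yoneda_exact₂ _ hZ (g ≫ a) e1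
    change Z ⟶ A at z
    change g ≫ a = f2 ≫ z at hz
    have e2 : ∀ i, ∃ y : (T i).obj₁⟦(1:ℤ)⟧ ⟶ A, c3.inj i ≫ a - γ i ≫ z = (T i).mor₃ ≫ y := by
      intro i
      refine Triangle.yoneda_exact₃ _ (hT i) _ ?_
      rw [Preadditive.comp_sub, ← Category.assoc, ← Category.assoc, hγ2, ← hg, Category.assoc,
        Category.assoc, hz, sub_self]
    choose y hy using e2
    let Y : c1.pt⟦(1:ℤ)⟧ ⟶ A := Cofan.IsColimit.desc s1 y
    have hY : ∀ i, (c1.inj i)⟦(1:ℤ)⟧' ≫ Y = y i := fun i => Cofan.IsColimit.fac s1 y i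
    refine ⟨z + f3 ≫ Y, ?_⟩
    refine Cofan.IsColimit.hom_ext h3 _ _ (fun i => ?_)
    rw [← Category.assoc, hΓ, Preadditive.comp_add, ← Category.assoc _ f3, ← hγ3, Category.assoc, hY, ← hy]
    abel
  have : IsIso Γ := by
    obtain ⟨δ, hδ⟩ := surj _ (𝟙 c3.pt)
    refine ⟨δ, hδ, ?_⟩
    rw [← sub_eq_zero]
    apply inj
    rw [Preadditive.comp_sub, ← Category.assoc, hδ]
    simp
  let e : c3.pt ≅ Z := asIso Γ
  have q : g ≫ Γ = f2 := by
    refine Cofan.IsColimit.hom_ext h2 _ _ (fun i => ?_)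
    rw [← Category.assoc, hg, Category.assoc, hΓ, hγ2]
  refine ⟨Γ ≫ f3, isomorphic_distinguished _ hZ _ (Triangle.isoMk _ _ (Iso.refl _) (Iso.refl _) e ?_ ?_ ?_)⟩
  · exact (Category.comp_id f).trans (Category.id_comp f).symm
  · exact q.trans (Category.id_comp f2).symm
  · change (Γ ≫ f3) ≫ (𝟙 c1.pt)⟦(1:ℤ)⟧' = Γ ≫ f3
    rw [CategoryTheory.Functor.map_id, Category.comp_id]
end Ctri

section Dtel
variable {R : Type} [CommRing R] [HasDerivedCategory.{w} (ModuleCat.{0} R)]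
  {S : Set (DerivedCategory (ModuleCat.{0} R))}
open DerivedCategory

lemma pre_ext (hS : IsCocompletePreaisle R S) (T : Triangle (DerivedCategory (ModuleCat.{0} R)))
    (hT : T ∈ distTriang _) (h1 : T.obj₁ ∈ S) (h3 : T.obj₃ ∈ S) : T.obj₂ ∈ S :=
  hS.ext_mem T.mor₁ T.mor₂ T.mor₃ hT h1 h3

lemma pre_zero (hS : IsCocompletePreaisle R S) (X : DerivedCategory (ModuleCat.{0} R))
    (hX : IsZero X) : X ∈ S := by
  let c : Cofan (fun e : Empty => (e.elim : DerivedCategory (ModuleCat.{0} R))) :=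
    Cofan.mk X (fun e => e.elim)
  refine hS.coproduct_mem _ c (Cofan.IsColimit.mk _ (fun s => hX.to_ _) (fun s e => e.elim)
    (fun s m hm => hX.eq_of_src _ _)) (fun e => e.elim)

/-- composites -/
noncomputable def telcmp {C : Type*} [Category C] {E : ℕ → C} (d : ∀ n, E n ⟶ E (n+1)) :
    ∀ n, E 0 ⟶ E n
  | 0 => 𝟙 _
  | (n+1) => telcmp d n ≫ d n

lemma telcmp_fiber (hS : IsCocompletePreaisle R S) (E F : ℕ → DerivedCategory (ModuleCat.{0} R))
    (d : ∀ n, E n ⟶ E (n+1)) (a : ∀ n, F n ⟶ E n) (b : ∀ n, E (n+1) ⟶ (F n)⟦(1:ℤ)⟧)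
    (hT : ∀ n, Triangle.mk (a n) (d n) (b n) ∈ distTriang _) (hF : ∀ n, F n ∈ S) (n : ℕ) :
    ∃ (X : DerivedCategory (ModuleCat.{0} R)) (_ : X ∈ S) (f : X ⟶ E 0) (g : E n ⟶ X⟦(1:ℤ)⟧),
      Triangle.mk f (telcmp d n) g ∈ distTriang _ := by
  induction n with
  | zero => exact ⟨_, pre_zero hS _ (isZero_zero _), 0, 0, contractible_distinguished₁ _⟩
  | succ n ih =>
    obtain ⟨X, hX, f, g, hfg⟩ := ih
    obtain ⟨X', f', g', h'⟩ := distinguished_cocone_triangle₁ (telcmp d n ≫ d n)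
    have o := Triangulated.someOctahedron' rfl hfg (hT n) h'
    exact ⟨X', pre_ext hS _ o.mem hX (hF n), f', g', h'⟩

lemma split_tel {N : DerivedCategory (ModuleCat.{0} R)}
    {c : Cofan (fun _ : ℕ => N)} (hc : IsColimit c)
    (σ : c.pt ⟶ c.pt) (hσ : ∀ n, c.inj n ≫ σ = c.inj n - c.inj (n+1))
    {Z : DerivedCategory (ModuleCat.{0} R)} (p : c.pt ⟶ Z) (w : Z ⟶ c.pt⟦(1:ℤ)⟧)
    (hT : Triangle.mk σ p w ∈ distTriang _) : Nonempty (Z ≅ N) := by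
  let r : c.pt ⟶ c.pt := Cofan.IsColimit.desc hc (fun n => - ∑ k ∈ Finset.range n, c.inj k)
  have hr : ∀ n, c.inj n ≫ r = - ∑ k ∈ Finset.range n, c.inj k := fun n => Cofan.IsColimit.fac hc _ n
  have hσr : σ ≫ r = 𝟙 _ := by
    refine Cofan.IsColimit.hom_ext hc _ _ (fun n => ?_)
    rw [← Category.assoc, hσ, Preadditive.sub_comp, hr, hr, Finset.sum_range_succ, Category.comp_id]
    abel
  have hw : w = 0 := by
    have h1 : w ≫ σ⟦(1:ℤ)⟧' = 0 := comp_distTriang_mor_zero₃₁ _ hT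
    have h2 : w ≫ (σ ≫ r)⟦(1:ℤ)⟧' = 0 := by
      rw [Functor.map_comp, ← Category.assoc, h1, zero_comp]
    rwa [hσr, CategoryTheory.Functor.map_id, Category.comp_id] at h2
  have epi : ∀ (A : DerivedCategory (ModuleCat.{0} R)) (z : Z ⟶ A), p ≫ z = 0 → z = 0 := by
    intro A z hz
    obtain ⟨y, hy⟩ := Triangle.yoneda_exact₃ _ hT z hz
    change c.pt⟦(1:ℤ)⟧ ⟶ A at y
    change z = w ≫ y at hy
    rw [hy, hw, zero_comp]
  have hσp : σ ≫ p = 0 := comp_distTriang_mor_zero₁₂ _ hT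
  let nab : c.pt ⟶ N := Cofan.IsColimit.desc hc (fun n => 𝟙 N)
  have hn : ∀ n, c.inj n ≫ nab = 𝟙 N := fun n => Cofan.IsColimit.fac hc _ n
  have hσn : σ ≫ nab = 0 := by
    refine Cofan.IsColimit.hom_ext hc _ _ (fun n => ?_)
    rw [← Category.assoc, hσ, Preadditive.sub_comp, hn, hn, sub_self, comp_zero]
  obtain ⟨q, hq⟩ := Triangle.yoneda_exact₂ _ hT nab hσn
  change Z ⟶ N at q
  change nab = p ≫ q at hq
  have hp : ∀ n, c.inj n ≫ p = c.inj 0 ≫ p := by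
    intro n
    induction n with
    | zero => rfl
    | succ n ih =>
      rw [← ih]
      have : c.inj n ≫ σ ≫ p = 0 := by rw [hσp, comp_zero]
      rw [← Category.assoc, hσ, Preadditive.sub_comp, sub_eq_zero] at this
      exact this.symm
  refine ⟨⟨q, c.inj 0 ≫ p, ?_, ?_⟩⟩
  · rw [← sub_eq_zero]
    apply epi
    rw [Preadditive.comp_sub, sub_eq_zero, ← Category.assoc, ← hq, Category.comp_id]
    refine Cofan.IsColimit.hom_ext hc _ _ (fun n => ?_)
    rw [← Category.assoc, hn, Category.id_comp]
    exact (hp n).symm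
  · rw [Category.assoc, ← hq, hn]

lemma telescope (hS : IsCocompletePreaisle R S) (E F : ℕ → DerivedCategory (ModuleCat.{0} R))
    (d : ∀ n, E n ⟶ E (n+1)) (a : ∀ n, F n ⟶ E n) (b : ∀ n, E (n+1) ⟶ (F n)⟦(1:ℤ)⟧)
    (hT : ∀ n, Triangle.mk (a n) (d n) (b n) ∈ distTriang _) (hF : ∀ n, F n ∈ S)
    (hd : ∀ n j, (homologyFunctor (ModuleCat.{0} R) j).map (d n) = 0) : E 0 ∈ S := by
  choose X hX f0 g0 hfg using telcmp_fiber hS E F d a b hT hF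
  obtain ⟨c1, h1, -⟩ := D_coprod X
  obtain ⟨c2, h2, -⟩ := D_coprod (fun _ : ℕ => E 0)
  obtain ⟨c3, h3, h3'⟩ := D_coprod E
  let f : c1.pt ⟶ c2.pt := Cofan.IsColimit.desc h1 (fun n => f0 n ≫ c2.inj n)
  have hf : ∀ n, c1.inj n ≫ f = f0 n ≫ c2.inj n := fun n => Cofan.IsColimit.fac h1 _ n
  let g : c2.pt ⟶ c3.pt := Cofan.IsColimit.desc h2 (fun n => telcmp d n ≫ c3.inj n)
  have hg : ∀ n, c2.inj n ≫ g = telcmp d n ≫ c3.inj n := fun n => Cofan.IsColimit.fac h2 _ n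
  obtain ⟨h, hfgh⟩ := coprod_triangle (fun n => Triangle.mk (f0 n) (telcmp d n) (g0 n)) hfg
    h1 h2 h3 f hf g hg
  let t : c3.pt ⟶ c3.pt := Cofan.IsColimit.desc h3 (fun n => d n ≫ c3.inj (n+1))
  have ht : ∀ n, c3.inj n ≫ t = d n ≫ c3.inj (n+1) := fun n => Cofan.IsColimit.fac h3 _ n
  have ht0 : ∀ j, (homologyFunctor (ModuleCat.{0} R) j).map t = 0 := by
    intro j
    refine h3' j _ _ (fun n => ?_)
    rw [← Functor.map_comp, ht, Functor.map_comp, hd, zero_comp]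
  let u := 𝟙 c3.pt - t
  have hu : IsIso u := by
    rw [isIso_iff]
    intro j
    have : (homologyFunctor (ModuleCat.{0} R) j).map u = 𝟙 _ := by
      simp only [u]
      rw [Functor.map_sub, ht0, CategoryTheory.Functor.map_id, sub_zero]
    rw [this]
    infer_instance
  let σ : c2.pt ⟶ c2.pt := Cofan.IsColimit.desc h2 (fun n => c2.inj n - c2.inj (n+1))
  have hσ : ∀ n, c2.inj n ≫ σ = c2.inj n - c2.inj (n+1) := fun n => Cofan.IsColimit.fac h2 _ n
  have comm : σ ≫ g = g ≫ u := by
    refine Cofan.IsColimit.hom_ext h2 _ _ (fun n => ?_)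
    rw [← Category.assoc, hσ, Preadditive.sub_comp, hg, hg, ← Category.assoc, hg, Category.assoc,
      Preadditive.comp_sub, ht, Preadditive.comp_sub, Category.comp_id, ← Category.assoc _ (d n)]
    rfl
  let e : c3.pt ≅ c3.pt := asIso u
  have hT1 : Triangle.mk g h (-f⟦(1:ℤ)⟧') ∈ distTriang _ := rot_of_distTriang _ hfgh
  have hT2 : Triangle.mk (g ≫ u) (e.inv ≫ h) (-f⟦(1:ℤ)⟧') ∈ distTriang _ := by
    refine isomorphic_distinguished _ hT1 _ (Triangle.isoMk _ _ (Iso.refl _) e.symm (Iso.refl _) ?_ ?_ ?_)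
    · change (g ≫ e.hom) ≫ e.inv = 𝟙 _ ≫ g
      simp
    · change (e.inv ≫ h) ≫ 𝟙 _ = e.inv ≫ h
      simp
    · change (-f⟦(1:ℤ)⟧') ≫ (𝟙 c2.pt)⟦(1:ℤ)⟧' = 𝟙 _ ≫ (-f⟦(1:ℤ)⟧')
      rw [CategoryTheory.Functor.map_id, Category.comp_id, Category.id_comp]
  obtain ⟨Z, p, w, hσT⟩ := distinguished_cocone_triangle σ
  have o := Triangulated.someOctahedron comm hσT hT1 hT2
  have hc1 : c1.pt ∈ S := hS.coproduct_mem X c1 h1 hX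
  have hZ : Z ∈ S := by
    refine pre_ext hS _ (inv_rot_of_distTriang _ o.mem) ?_ (hS.shift_mem hc1)
    exact hS.mem_of_iso (shiftShiftNeg c1.pt (1:ℤ)).symm hc1
  obtain ⟨i⟩ := split_tel h2 σ hσ p w hσT
  exact hS.mem_of_iso i hZ
end Dtel

section Esdeg
variable {R : Type} [CommRing R] [HasDerivedCategory.{w} (ModuleCat.{0} R)]
  {S : Set (DerivedCategory (ModuleCat.{0} R))}
open DerivedCategory

lemma sdeg_coprod (hS : IsCocompletePreaisle R S) (m : ℤ) {ι : Type} (X : ι → ModuleCat.{0} R)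
    (c : Cofan X) (hc : IsColimit c) (h : ∀ i, sdeg R m (X i) ∈ S) : sdeg R m c.pt ∈ S := by
  let G := HomologicalComplex.single (ModuleCat.{0} R) (ComplexShape.up ℤ) (-m)
  have h1 : IsColimit (Cofan.mk (G.obj c.pt) (fun i => G.map (c.inj i)) : Cofan (fun i => G.obj (X i))) :=
    isColimitCofanMkObjOfIsColimit G X c.inj (hc.ofIsoColimit (Cocone.ext (Iso.refl _) (by
      rintro ⟨j⟩; simp; rfl)))
  obtain ⟨h2⟩ := Q_coprod h1
  exact hS.coproduct_mem _ _ h2 h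

lemma sdeg_triangle (m : ℤ) {T : ShortComplex (ModuleCat.{0} R)} (hT : T.ShortExact) :
    ∃ (a : sdeg R m T.X₁ ⟶ sdeg R m T.X₂) (b : sdeg R m T.X₂ ⟶ sdeg R m T.X₃) (h : _),
      Triangle.mk a b h ∈ distTriang _ :=
  ⟨_, _, _, triangleOfSES_distinguished
    (hT.map_of_exact (HomologicalComplex.single (ModuleCat.{0} R) (ComplexShape.up ℤ) (-m)))⟩

lemma sdeg_shift (m : ℤ) (K : ModuleCat.{0} R) : Nonempty ((sdeg R m K)⟦(1:ℤ)⟧ ≅ sdeg R (m+1) K) :=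
  ⟨((singleFunctors (ModuleCat.{0} R)).shiftIso 1 (-(m+1)) (-m) (by ring)).app K⟩

lemma sdeg_step (m : ℤ) {T : ShortComplex (ModuleCat.{0} R)} (hT : T.ShortExact) :
    ∃ (a : sdeg R m T.X₂ ⟶ sdeg R m T.X₃) (d : sdeg R m T.X₃ ⟶ sdeg R (m+1) T.X₁) (b : _),
      Triangle.mk a d b ∈ distTriang _ := by
  obtain ⟨f, g, h, H⟩ := sdeg_triangle m hT
  obtain ⟨e⟩ := sdeg_shift m T.X₁
  refine ⟨g, h ≫ e.hom, e.inv ≫ (-f⟦(1:ℤ)⟧'), isomorphic_distinguished _ (rot_of_distTriang _ H) _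
    (Triangle.isoMk _ _ (Iso.refl _) (Iso.refl _) e.symm ?_ ?_ ?_)⟩
  · exact (Category.comp_id g).trans (Category.id_comp g).symm
  · change (h ≫ e.hom) ≫ e.inv = 𝟙 _ ≫ h
    simp
  · change (e.inv ≫ (-f⟦(1:ℤ)⟧')) ≫ (𝟙 (sdeg R m T.X₂))⟦(1:ℤ)⟧' = e.inv ≫ (-f⟦(1:ℤ)⟧')
    rw [CategoryTheory.Functor.map_id, Category.comp_id]

lemma sdeg_map_zero (m n : ℤ) (hmn : m ≠ n) (K L : ModuleCat.{0} R) (d : sdeg R m K ⟶ sdeg R n L) (j : ℤ) :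
    (homologyFunctor (ModuleCat.{0} R) j).map d = 0 := by
  have key : ∀ (m : ℤ) (K : ModuleCat.{0} R), j ≠ -m → IsZero ((homologyFunctor (ModuleCat.{0} R) j).obj (sdeg R m K)) := by
    intro m K hj
    rcases lt_or_gt_of_ne hj with h | h
    · exact isZero_of_isGE ((singleFunctor (ModuleCat.{0} R) (-m)).obj K) (-m) j h
    · exact isZero_of_isLE ((singleFunctor (ModuleCat.{0} R) (-m)).obj K) (-m) j h
  by_cases h : j = -m
  · exact (key n L (by omega)).eq_of_tgt _ _
  · exact (key m K h).eq_of_src _ _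

lemma sdeg_iso (hS : IsCocompletePreaisle R S) (m : ℤ) {K L : ModuleCat.{0} R} (e : K ≅ L)
    (h : sdeg R m K ∈ S) : sdeg R m L ∈ S :=
  hS.mem_of_iso ((singleFunctor (ModuleCat.{0} R) (-m)).mapIso e) h

lemma sdeg_zero (hS : IsCocompletePreaisle R S) (m : ℤ) {K : ModuleCat.{0} R} (h : IsZero K) :
    sdeg R m K ∈ S :=
  pre_zero hS _ ((singleFunctor (ModuleCat.{0} R) (-m)).map_isZero h)

lemma sdeg_suspend (hS : IsCocompletePreaisle R S) (m : ℤ) (n : ℕ) (K : ModuleCat.{0} R)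
    (h : sdeg R m K ∈ S) : sdeg R (m + n) K ∈ S := by
  induction n with
  | zero => simpa using h
  | succ n ih =>
    obtain ⟨e⟩ := sdeg_shift (m + n) K
    have := hS.mem_of_iso e (hS.shift_mem ih)
    rwa [add_assoc] at this
end Esdeg

section Fmod
variable {R : Type} [CommRing R] [HasDerivedCategory.{w} (ModuleCat.{0} R)]
  {S : Set (DerivedCategory (ModuleCat.{0} R))}
open DerivedCategory

lemma ses_mk {A B C : Type} [AddCommGroup A] [AddCommGroup B] [AddCommGroup C]
    [Module R A] [Module R B] [Module R C] (f : A →ₗ[R] B) (g : B →ₗ[R] C)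
    (hf : Function.Injective f) (hg : Function.Surjective g) (h : Function.Exact f g) :
    ∃ w, (ShortComplex.mk (ModuleCat.ofHom f) (ModuleCat.ofHom g) w).ShortExact := by
  have w : ModuleCat.ofHom f ≫ ModuleCat.ofHom g = 0 := by
    ext x
    exact h.apply_apply_eq_zero x
  refine ⟨w, ?_⟩
  have h1 : Mono (ModuleCat.ofHom f) := (ModuleCat.mono_iff_injective _).2 hf
  have h2 : Epi (ModuleCat.ofHom g) := (ModuleCat.epi_iff_surjective _).2 hg
  exact { exact := (ShortComplex.ShortExact.moduleCat_exact_iff_function_exact _).2 h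
          mono_f := h1
          epi_g := h2 }

lemma sdeg_fin [IsNoetherianRing R] (hS : IsCocompletePreaisle R S) (m : ℤ)
    (V : Set (PrimeSpectrum R))
    (hV : ∀ p ∈ V, sdeg R m (ModuleCat.of R (R ⧸ p.asIdeal)) ∈ S)
    (K : Type) [AddCommGroup K] [Module R K] [hK : Module.Finite R K]
    (hsupp : Module.support R K ⊆ V) : sdeg R m (ModuleCat.of R K) ∈ S := by
  revert hsupp
  refine IsNoetherianRing.induction_on_isQuotientEquivQuotientPrime R hK
    (motive := fun K _ _ _ => Module.support R K ⊆ V → sdeg R m (ModuleCat.of R K) ∈ S) ?_ ?_ ?_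
  · intro N _ _ _ _ _
    exact sdeg_zero hS m (ModuleCat.isZero_of_subsingleton _)
  · intro N _ _ _ p e h
    refine sdeg_iso hS m e.symm.toModuleIso (hV p (h ?_))
    rw [e.support_eq, Module.mem_support_iff_of_finite, Ideal.annihilator_quotient]
  · intro N₁ _ _ _ N₂ _ _ _ N₃ _ _ _ f g hf hg hfg h1 h3 h2
    rw [Module.support_of_exact hfg hf hg] at h2
    obtain ⟨w, hw⟩ := ses_mk f g hf hg hfg
    obtain ⟨a, b, c, hT⟩ := sdeg_triangle m hw
    exact pre_ext hS _ hT (h1 (Set.subset_union_left.trans h2)) (h3 (Set.subset_union_right.trans h2))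

lemma supp_directSum {ι : Type} [DecidableEq ι] (K : ι → Type) [∀ i, AddCommGroup (K i)] [∀ i, Module R (K i)]
    (V : Set (PrimeSpectrum R)) (h : ∀ i, Module.support R (K i) ⊆ V) :
    Module.support R (DirectSum ι K) ⊆ V := by
  intro p hp
  by_contra hV
  revert hp
  change p ∉ _
  rw [Module.notMem_support_iff']
  intro x
  induction x using DirectSum.induction_on with
  | zero => exact ⟨1, p.2.one_notMem, smul_zero _⟩
  | of i x =>
    have : p ∉ Module.support R (K i) := fun hp => hV (h i hp)
    obtain ⟨r, hr, hx⟩ := Module.notMem_support_iff'.1 this x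
    refine ⟨r, hr, ?_⟩
    change r • DirectSum.lof R ι K i x = 0
    rw [← map_smul, hx, map_zero]
  | add x y hx hy =>
    obtain ⟨r, hr, hx⟩ := hx
    obtain ⟨s, hs, hy⟩ := hy
    refine ⟨r * s, fun h => (p.2.mem_or_mem h).elim hr hs, ?_⟩
    have e1 : (r * s) • x = 0 := by rw [mul_comm, mul_smul, hx, smul_zero]
    have e2 : (r * s) • y = 0 := by rw [mul_smul, hy, smul_zero]
    rw [smul_add, e1, e2, add_zero]

lemma supp_step [IsNoetherianRing R] (V : Set (PrimeSpectrum R)) (K : ModuleCat.{0} R)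
    (hK : Module.support R K ⊆ V) :
    ∃ (K' : ModuleCat.{0} R) (_ : Module.support R K' ⊆ V) (P : ModuleCat.{0} R)
      (f : K' ⟶ P) (g : P ⟶ K) (h : f ≫ g = 0), (ShortComplex.mk f g h).ShortExact ∧
      ∀ (S : Set (DerivedCategory (ModuleCat.{0} R))) (_ : IsCocompletePreaisle R S) (m : ℤ)
        (_ : ∀ p ∈ V, sdeg R m (ModuleCat.of R (R ⧸ p.asIdeal)) ∈ S), sdeg R m P ∈ S := by
  classical
  let A : K → Submodule R K := fun x => Submodule.span R {x}
  let P := DirectSum K (fun x => A x)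
  let g : P →ₗ[R] K := DirectSum.toModule R K K (fun x => (A x).subtype)
  have hg : Function.Surjective g := fun x =>
    ⟨DirectSum.lof R K (fun x => A x) x ⟨x, Submodule.mem_span_singleton_self x⟩, by
      simp only [g]
      rw [DirectSum.toModule_lof]; rfl⟩
  have hA : ∀ x, Module.support R (A x) ⊆ V := fun x =>
    (Module.support_subset_of_injective (A x).subtype (A x).injective_subtype).trans hK
  have hP : Module.support R P ⊆ V := supp_directSum (fun x => A x) V hA
  let i : LinearMap.ker g →ₗ[R] P := (LinearMap.ker g).subtype
  have hi : Function.Injective i := (LinearMap.ker g).injective_subtype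
  have hex : Function.Exact i g := LinearMap.exact_subtype_ker_map g
  obtain ⟨w, hw⟩ := ses_mk (A := LinearMap.ker g) (B := P) (C := K) i g hi hg hex
  refine ⟨_, (Module.support_subset_of_injective i hi).trans hP, _, _, _, w, hw, ?_⟩
  intro S hS m hV
  exact sdeg_coprod hS m _ _ (ModuleCat.coproductCoconeIsColimit (fun x => ModuleCat.of R (A x)))
    (fun x => sdeg_fin hS m V hV (A x) (hA x))

lemma sdeg_mem [IsNoetherianRing R] (hS : IsCocompletePreaisle R S) (m : ℤ)
    (V : Set (PrimeSpectrum R))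
    (hV : ∀ p ∈ V, sdeg R m (ModuleCat.of R (R ⧸ p.asIdeal)) ∈ S)
    (K : ModuleCat.{0} R) (hK : Module.support R K ⊆ V) : sdeg R m K ∈ S := by
  choose K' hK' P f g h0 hse hP using fun K : {K : ModuleCat.{0} R // Module.support R K ⊆ V} =>
    supp_step V K.1 K.2
  let s : ℕ → {K : ModuleCat.{0} R // Module.support R K ⊆ V} := fun n =>
    Nat.rec ⟨K, hK⟩ (fun _ L => ⟨K' L, hK' L⟩) n
  have hst : ∀ n : ℕ, ∃ (a : sdeg R (m + n) (P (s n)) ⟶ sdeg R (m + n) (s n).1)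
      (d : sdeg R (m + n) (s n).1 ⟶ sdeg R (m + (n + 1 : ℕ)) (s (n+1)).1) (b : _),
      Triangle.mk a d b ∈ distTriang _ := by
    intro n
    have := sdeg_step (m + n) (hse (s n))
    rw [add_assoc] at this
    exact this
  choose a d b hT using hst
  have := telescope hS (fun n : ℕ => sdeg R (m + n) (s n).1) (fun n : ℕ => sdeg R (m + n) (P (s n)))
    d a b hT (fun n => hP (s n) S hS (m + n) (fun p hp => sdeg_suspend hS m n _ (hV p hp)))
    (fun n j => sdeg_map_zero _ _ (by push_cast; omega) _ _ _ _)
  have e : sdeg R (m + (0:ℕ)) K ∈ S := this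
  simpa using e

lemma supp_ass [IsNoetherianRing R] (K : Type) [AddCommGroup K] [Module R K] :
    Module.support R K ⊆ {p | ∃ q ∈ associatedPrimes R K, q ≤ p.asIdeal} := by
  intro p hp
  obtain ⟨x, hx⟩ := Module.mem_support_iff_exists_annihilator.1 hp
  obtain ⟨q, hq, hqp⟩ := Ideal.exists_minimalPrimes_le hx
  have h1 := Module.associatedPrimes.minimalPrimes_annihilator_subset_associatedPrimes R (Submodule.span R {x}) hq
  exact ⟨q, associatedPrimes.subset_of_injective (Submodule.injective_subtype _) h1, hqp⟩
end Fmod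

section Gtrunc
variable {R : Type} [CommRing R] [HasDerivedCategory.{w} (ModuleCat.{0} R)]
  {S : Set (DerivedCategory (ModuleCat.{0} R))}
open DerivedCategory

lemma mem_single (hS : IsCocompletePreaisle R S) (X : DerivedCategory (ModuleCat.{0} R)) (a : ℤ)
    (h1 : X.IsGE a) (h2 : X.IsLE a)
    (h : (singleFunctor (ModuleCat.{0} R) a).obj ((homologyFunctor _ a).obj X) ∈ S) : X ∈ S := by
  obtain ⟨Y, ⟨e⟩⟩ := exists_iso_singleFunctor_obj_of_isGE_of_isLE X a
  let e' : (homologyFunctor _ a).obj X ≅ Y := (homologyFunctor _ a).mapIso e ≪≫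
    (singleFunctorCompHomologyFunctorIso (ModuleCat.{0} R) a).app Y
  exact hS.mem_of_iso ((singleFunctor (ModuleCat.{0} R) a).mapIso e' ≪≫ e.symm) h

lemma mem_bounded (hS : IsCocompletePreaisle R S) (n : ℕ) : ∀ (a : ℤ)
    (X : DerivedCategory (ModuleCat.{0} R)) (_ : X.IsGE a) (_ : X.IsLE (a + n))
    (_ : ∀ j, (singleFunctor (ModuleCat.{0} R) j).obj ((homologyFunctor _ j).obj X) ∈ S), X ∈ S := by
  induction n with
  | zero =>
    intro a X h1 h2 h
    exact mem_single hS X a h1 (by simpa using h2) (h a)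
  | succ n ih =>
    intro a M hM1 hM2 h
    obtain ⟨X, Y, hX, hY, f, g, k, hT⟩ := (TStructure.t (C := ModuleCat.{0} R)).exists_triangle M a (a+1) rfl
    have hX' : X.IsLE a := ⟨hX⟩
    have hY' : Y.IsGE (a+1) := ⟨hY⟩
    have hf : ∀ j, j ≤ a → IsIso ((homologyFunctor _ j).map f) := by
      intro j hj
      have : Mono ((homologyFunctor _ j).map f) :=
        (HomologySequence.mono_homologyMap_mor₁_iff _ hT (j-1) j (by omega)).2
          ((isZero_of_isGE Y (a+1) (j-1) (by omega)).eq_of_src _ _)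
      have : Epi ((homologyFunctor _ j).map f) :=
        (HomologySequence.epi_homologyMap_mor₁_iff _ hT j).2
          ((isZero_of_isGE Y (a+1) j (by omega)).eq_of_tgt _ _)
      exact isIso_of_mono_of_epi _
    have hg : ∀ j, a + 1 ≤ j → IsIso ((homologyFunctor _ j).map g) := by
      intro j hj
      have : Mono ((homologyFunctor _ j).map g) :=
        (HomologySequence.mono_homologyMap_mor₂_iff _ hT j).2
          ((isZero_of_isLE X a j (by omega)).eq_of_src _ _)
      have : Epi ((homologyFunctor _ j).map g) :=
        (HomologySequence.epi_homologyMap_mor₂_iff _ hT j (j+1) (by omega)).2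
          ((isZero_of_isLE X a (j+1) (by omega)).eq_of_tgt _ _)
      exact isIso_of_mono_of_epi _
    have hXS : X ∈ S := by
      refine mem_single hS X a ?_ hX' ?_
      · rw [isGE_iff]
        intro i hi
        have := hf i hi.le
        exact (isZero_of_isGE M a i hi).of_iso (asIso ((homologyFunctor _ i).map f))
      · have := hf a le_rfl
        exact hS.mem_of_iso ((singleFunctor (ModuleCat.{0} R) a).mapIso
          (asIso ((homologyFunctor _ a).map f)).symm) (h a)
    have hYS : Y ∈ S := by
      refine ih (a+1) Y hY' ?_ ?_
      · rw [isLE_iff]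
        intro i hi
        have := hg i (by omega)
        exact (isZero_of_isLE M (a + (n+1 : ℕ)) i (by push_cast; omega)).of_iso
          (asIso ((homologyFunctor _ i).map g)).symm
      · intro j
        by_cases hj : a + 1 ≤ j
        · have := hg j hj
          exact hS.mem_of_iso ((singleFunctor (ModuleCat.{0} R) j).mapIso
            (asIso ((homologyFunctor _ j).map g))) (h j)
        · exact pre_zero hS _ ((singleFunctor (ModuleCat.{0} R) j).map_isZero
            (isZero_of_isGE Y (a+1) j (by omega)))
    exact hS.ext_mem f g k hT hXS hYS
end Gtrunc

/-- Let `R` be Noetherian and `M ∈ D(R)` with `H_i(M) = 0` for all but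
finitely many `i`. Let `S` be any cocomplete preaisle in `D(R)` containing `s^i (R/p)`
for every `i : ℤ` and every prime `p` in the specialization closure of `Ass H_i(M)`.
Then `M ∈ S`. -/
theorem stmt7 (R : Type) [CommRing R] [IsNoetherianRing R]
    [HasDerivedCategory.{w} (ModuleCat R)]
    (M : DerivedCategory (ModuleCat R))
    (hfin : {i : ℤ | ¬ IsZero (Hh R i M)}.Finite)
    (S : Set (DerivedCategory (ModuleCat R))) (hS : IsCocompletePreaisle R S)
    (hgen : ∀ (i : ℤ) (p : Ideal R), p.IsPrime →
      (∃ q ∈ associatedPrimes R ↥(Hh R i M), q ≤ p) →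
      sdeg R i (ModuleCat.of R (R ⧸ p)) ∈ S) :
    M ∈ S := by
  have key : ∀ i, sdeg R i (Hh R i M) ∈ S := fun i =>
    sdeg_mem hS i {p | ∃ q ∈ associatedPrimes R ↥(Hh R i M), q ≤ p.asIdeal}
      (fun p hp => hgen i p.asIdeal p.2 hp) _ (supp_ass _)
  obtain ⟨u, hu⟩ := hfin.bddAbove
  obtain ⟨l, hl⟩ := hfin.bddBelow
  have hz : ∀ j : ℤ, (u < -j ∨ -j < l) → IsZero ((DerivedCategory.homologyFunctor (ModuleCat R) j).obj M) := by
    intro j hj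
    by_contra hcon
    have hm : (-j) ∈ {i : ℤ | ¬ IsZero (Hh R i M)} := by
      change ¬ IsZero ((DerivedCategory.homologyFunctor (ModuleCat R) (- -j)).obj M)
      rwa [neg_neg]
    have h1 := hu hm
    have h2 := hl hm
    omega
  refine mem_bounded hS (u - l).toNat (-u) M ?_ ?_ (fun j => ?_)
  · rw [DerivedCategory.isGE_iff]
    intro i hi
    exact hz i (by omega)
  · rw [DerivedCategory.isLE_iff]
    intro i hi
    exact hz i (by omega)
  · have := key (-j)
    change (DerivedCategory.singleFunctor (ModuleCat R) (- -j)).obj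
      ((DerivedCategory.homologyFunctor (ModuleCat R) (- -j)).obj M) ∈ S at this
    rwa [neg_neg] at this
end
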